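/- Fix e ∈ (0,2) and a lattice direction x⁰ = (m₀, n₀) ∈ ℤ² with m₀, n₀ ≥ 0 not both zero, and let φ ∈ [0, π/2] be the polar angle of x⁰. Let θ_s ∈ [0, π/2] be a stationary point of θ ↦ K(e,θ) cos(φ - θ), set K_s = K(e, θ_s) and ψ(e,φ) = cos(K_s cos θ_s) sin(K_s sin θ_s) sin φ + cos(K_s sin θ_s) sin(K_s cos θ_s) cos φ. Then, with r_j = j·|x⁰| (Euclidean norm), the boundary value of the Green's function has the leading asymptotics of an outgoing circular wave along the ray: √(2π ψ(e,φ) r_j) · g₊(e; j m₀, j n₀) - exp(i (r_j K_s cos(φ - θ_s) + π/4)) → 0 as j → ∞. -/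

import Mathlib

open MeasureTheory Real Complex

/-- The lattice Green's function of the 2D discrete Laplacian:
`g(z; x₁, x₂) = (2π)⁻² ∫_{[-π,π]²} e^{-i(k₁x₁+k₂x₂)} / (ω(k) - z) dk`. -/
noncomputable def latticeGreen (z : ℂ) (x₁ x₂ : ℤ) : ℂ :=
  ((2 * Real.pi) ^ 2)⁻¹ •
    ∫ k in Set.Icc ((-Real.pi, -Real.pi) : ℝ × ℝ) ((Real.pi, Real.pi) : ℝ × ℝ),
      Complex.exp (-Complex.I * ((k.1 : ℂ) * (x₁ : ℂ) + (k.2 : ℂ) * (x₂ : ℂ))) /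
        (((2 - Real.cos k.1 - Real.cos k.2 : ℝ) : ℂ) - z)

/-- The branch of `√(1 - a²)` whose cut is where `1 - a²` lies on the negative imaginary axis. -/
noncomputable def cutSqrt (a : ℂ) : ℂ :=
  Complex.exp ((Real.pi / 4 : ℝ) * Complex.I) * (-Complex.I * (1 - a ^ 2)) ^ (1 / 2 : ℂ)

/-- The root `λ = a + i√(1 - a²)` of `λ + λ⁻¹ = 2a`. -/
noncomputable def joukowski (a : ℂ) : ℂ := a + Complex.I * cutSqrt a

theorem cutSqrt_sq (a : ℂ) : cutSqrt a ^ 2 = 1 - a ^ 2 := by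
  have h1 : (Complex.exp ((Real.pi / 4 : ℝ) * Complex.I)) ^ 2 = Complex.I := by
    rw [← Complex.exp_nat_mul]
    have : ((2 : ℕ) : ℂ) * (((Real.pi / 4 : ℝ) : ℂ) * Complex.I) = Real.pi / 2 * Complex.I := by
      push_cast; ring
    rw [this, Complex.exp_pi_div_two_mul_I]
  have h2 : ((-Complex.I * (1 - a ^ 2)) ^ (1 / 2 : ℂ)) ^ 2 = -Complex.I * (1 - a ^ 2) := by
    have := Complex.cpow_nat_inv_pow (-Complex.I * (1 - a ^ 2)) (n := 2) two_ne_zero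
    rwa [Nat.cast_ofNat, ← one_div] at this
  rw [cutSqrt, mul_pow, h1, h2]
  linear_combination (-(1 - a ^ 2)) * Complex.I_sq

theorem joukowski_mul (a : ℂ) : joukowski a * (a - Complex.I * cutSqrt a) = 1 := by
  have := cutSqrt_sq a
  rw [joukowski]
  linear_combination this - cutSqrt a ^ 2 * Complex.I_sq

theorem joukowski_ne_zero (a : ℂ) : joukowski a ≠ 0 :=
  left_ne_zero_of_mul_eq_one (joukowski_mul a)

theorem joukowski_inv (a : ℂ) : (joukowski a)⁻¹ = a - Complex.I * cutSqrt a :=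
  inv_eq_of_mul_eq_one_right (joukowski_mul a)

theorem cutSqrt_re_add_im (a : ℂ) :
    (cutSqrt a).re + (cutSqrt a).im =
      √2 * ((-Complex.I * (1 - a ^ 2)) ^ (1 / 2 : ℂ)).re := by
  have h : Complex.exp ((Real.pi / 4 : ℝ) * Complex.I) =
      (√2 / 2 : ℝ) + (√2 / 2 : ℝ) * Complex.I := by
    rw [Complex.exp_mul_I, ← Complex.ofReal_cos, ← Complex.ofReal_sin, Real.cos_pi_div_four,
      Real.sin_pi_div_four]
  rw [cutSqrt, h]
  simp only [Complex.mul_re, Complex.mul_im, Complex.add_re, Complex.add_im, Complex.ofReal_re,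
    Complex.ofReal_im, Complex.I_re, Complex.I_im]
  ring

/-- The part of the plane on which the branch `cutSqrt` is used. -/
def branchDomain : Set ℂ :=
  {a | -1 < a.re ∧ (a.re < 1 ∨ a.im < 0 ∨ (1 < a.re ∧ a.im ≤ 0))}

theorem mem_slitPlane_of_mem_branchDomain {a : ℂ} (ha : a ∈ branchDomain) :
    -Complex.I * (1 - a ^ 2) ∈ Complex.slitPlane := by
  obtain ⟨h1, h2⟩ := ha
  rw [Complex.mem_slitPlane_iff]
  have e1 : (-Complex.I * (1 - a ^ 2)).re = -2 * a.re * a.im := by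
    simp [pow_two]; ring
  have e2 : (-Complex.I * (1 - a ^ 2)).im = -(1 - a.re ^ 2 + a.im ^ 2) := by
    simp [pow_two]; ring
  rw [e1, e2]
  by_contra! hcon
  obtain ⟨h3, h4⟩ := hcon
  rcases h2 with h | h | ⟨h, h'⟩
  · nlinarith [sq_nonneg a.im]
  · nlinarith [sq_nonneg a.im, mul_pos_of_neg_of_neg h h]
  · have : a.im ≠ 0 := by
      intro h0; rw [h0] at h4; nlinarith
    have : a.im < 0 := lt_of_le_of_ne h' this
    nlinarith

theorem cutSqrt_ne_zero {a : ℂ} (ha : a ∈ branchDomain) : cutSqrt a ≠ 0 := by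
  have h := Complex.slitPlane_ne_zero (mem_slitPlane_of_mem_branchDomain ha)
  intro h0
  have := cutSqrt_sq a
  rw [h0] at this
  apply h
  rw [← this]; simp

theorem cutSqrt_re_add_im_pos {a : ℂ} (ha : a ∈ branchDomain) :
    0 < (cutSqrt a).re + (cutSqrt a).im := by
  rw [cutSqrt_re_add_im]
  have h := mem_slitPlane_of_mem_branchDomain ha
  have h0 := Complex.slitPlane_ne_zero h
  apply mul_pos (by positivity)
  rw [Complex.cpow_def_of_ne_zero h0, Complex.exp_re]
  apply mul_pos (Real.exp_pos _)
  have him : (Complex.log (-Complex.I * (1 - a ^ 2)) * (1 / 2)).im =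
      Complex.arg (-Complex.I * (1 - a ^ 2)) / 2 := by
    rw [show (1 / 2 : ℂ) = ((1 / 2 : ℝ) : ℂ) by norm_num, Complex.im_mul_ofReal, Complex.log_im]
    ring
  rw [him]
  have h1 := Complex.neg_pi_lt_arg (-Complex.I * (1 - a ^ 2))
  have h2 := Complex.arg_lt_pi_iff.2
    ((Complex.mem_slitPlane_iff.1 h).imp_left le_of_lt)
  apply Real.cos_pos_of_mem_Ioo
  constructor <;> linarith

theorem cutSqrt_re_im (a : ℂ) :
    (cutSqrt a).re ^ 2 - (cutSqrt a).im ^ 2 = 1 - a.re ^ 2 + a.im ^ 2 ∧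
      (cutSqrt a).re * (cutSqrt a).im = -(a.re * a.im) := by
  have h := cutSqrt_sq a
  have h1 := congrArg Complex.re h
  have h2 := congrArg Complex.im h
  simp [pow_two] at h1 h2
  constructor <;> nlinarith

theorem cutSqrt_re_pos {a : ℂ} (h1 : -1 < a.re) (h2 : a.re < 1 ∨ a.im < 0) :
    0 < (cutSqrt a).re := by
  have hs := cutSqrt_re_add_im_pos (a := a) ⟨h1, by tauto⟩
  obtain ⟨e1, e2⟩ := cutSqrt_re_im a
  by_contra! hcon
  by_cases h : a.re < 1
  · nlinarith [sq_nonneg a.im]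
  · have h3 : a.im < 0 := by tauto
    push Not at h
    nlinarith

theorem norm_joukowski_lt_one_iff (a : ℂ) :
    ‖joukowski a‖ < 1 ↔ a.im * (cutSqrt a).re < a.re * (cutSqrt a).im := by
  have h1 : ‖joukowski a‖ * ‖a - Complex.I * cutSqrt a‖ = 1 := by
    rw [← norm_mul, joukowski_mul, norm_one]
  have h2 : ‖joukowski a‖ ^ 2 - ‖a - Complex.I * cutSqrt a‖ ^ 2 =
      4 * (a.im * (cutSqrt a).re - a.re * (cutSqrt a).im) := by
    rw [← Complex.normSq_eq_norm_sq, ← Complex.normSq_eq_norm_sq, Complex.normSq_apply,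
      Complex.normSq_apply, joukowski]
    simp
    ring
  have h3 := norm_nonneg (joukowski a)
  have h4 := norm_nonneg (a - Complex.I * cutSqrt a)
  constructor
  · intro h
    nlinarith
  · intro h
    by_contra! hcon
    nlinarith

theorem norm_joukowski_lt_one {a : ℂ} (h1 : -1 < a.re)
    (h2 : a.im < 0 ∨ (1 < a.re ∧ a.im = 0)) : ‖joukowski a‖ < 1 := by
  rw [norm_joukowski_lt_one_iff]
  obtain ⟨e1, e2⟩ := cutSqrt_re_im a
  rcases h2 with h | ⟨h, h'⟩
  · have hp := cutSqrt_re_pos h1 (Or.inr h)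
    by_contra! hcon
    have : a.im * (cutSqrt a).re ^ 2 ≥ -(a.re ^ 2 * a.im) := by nlinarith
    nlinarith [mul_pos hp hp, sq_nonneg a.re]
  · have hs := cutSqrt_re_add_im_pos (a := a) ⟨h1, Or.inr (Or.inr ⟨h, h'.le⟩)⟩
    rw [h'] at e1 e2 ⊢
    simp only [mul_zero, neg_zero, mul_eq_zero] at e2
    rcases e2 with e2 | e2
    · rw [e2] at hs ⊢
      nlinarith
    · rw [e2] at e1
      nlinarith [sq_nonneg (cutSqrt a).re]

/-- `joukowski a = exp (i q)` with `cos q = a` and `sin q = cutSqrt a`. -/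
theorem exists_joukowski_eq_exp (a : ℂ) :
    ∃ q : ℂ, joukowski a = Complex.exp (Complex.I * q) ∧ Complex.cos q = a ∧
      Complex.sin q = cutSqrt a := by
  refine ⟨-Complex.I * Complex.log (joukowski a), ?_, ?_, ?_⟩
  · rw [← mul_assoc]; simp [Complex.exp_log (joukowski_ne_zero a)]
  all_goals
    have e1 : -Complex.I * Complex.log (joukowski a) * Complex.I = Complex.log (joukowski a) := by
      linear_combination (-Complex.log (joukowski a)) * Complex.I_sq
    have e2 : -(-Complex.I * Complex.log (joukowski a)) * Complex.I =
        -Complex.log (joukowski a) := by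
      linear_combination (Complex.log (joukowski a)) * Complex.I_sq
  · rw [Complex.cos, e1, e2, Complex.exp_neg, Complex.exp_log (joukowski_ne_zero a),
      joukowski_inv, joukowski]
    ring
  · rw [Complex.sin, e1, e2, Complex.exp_neg, Complex.exp_log (joukowski_ne_zero a),
      joukowski_inv]
    unfold joukowski
    linear_combination (-cutSqrt a) * Complex.I_sq

theorem hasDerivAt_cutSqrt {a : ℂ} (ha : a ∈ branchDomain) :
    HasDerivAt cutSqrt (-a / cutSqrt a) a := by
  have h := mem_slitPlane_of_mem_branchDomain ha
  have hd : HasDerivAt (fun a : ℂ => -Complex.I * (1 - a ^ 2)) (-Complex.I * (-(2 * a))) a := by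
    have := ((hasDerivAt_id a).pow 2).const_sub 1 |>.const_mul (-Complex.I)
    simpa using this
  have hd2 : DifferentiableAt ℂ cutSqrt a :=
    (((hd.cpow_const (c := 1 / 2) h).const_mul
      (Complex.exp ((Real.pi / 4 : ℝ) * Complex.I)))).differentiableAt
  have h1 := (hd2.hasDerivAt).pow 2
  have h2 : HasDerivAt (fun a : ℂ => 1 - a ^ 2) (-(2 * a)) a := by
    have := ((hasDerivAt_id a).pow 2).const_sub 1
    simpa using this
  have h3 : (fun a : ℂ => 1 - a ^ 2) = cutSqrt ^ 2 := by
    ext x; simp [cutSqrt_sq]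
  rw [h3] at h2
  have h4 := h1.unique h2
  have h5 : deriv cutSqrt a = -a / cutSqrt a := by
    rw [eq_div_iff (cutSqrt_ne_zero ha)]
    simp at h4
    linear_combination h4 / 2
  rw [← h5]
  exact hd2.hasDerivAt

theorem hasDerivAt_joukowski {a : ℂ} (ha : a ∈ branchDomain) :
    HasDerivAt joukowski (-Complex.I * joukowski a / cutSqrt a) a := by
  have h := (hasDerivAt_id a).add ((hasDerivAt_cutSqrt ha).const_mul Complex.I)
  have h0 := cutSqrt_ne_zero ha
  refine (h.congr_deriv ?_ : HasDerivAt (fun a => a + Complex.I * cutSqrt a) _ a)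
  rw [joukowski]
  field_simp
  linear_combination (cutSqrt a) * Complex.I_sq

theorem continuous_cutSqrt_at {a : ℂ} (ha : -1 < a.re) (ha' : a.im ≤ 0) :
    ContinuousAt cutSqrt a := by
  by_cases h : a = 1
  · subst h
    have h1 : cutSqrt 1 = 0 := by
      have := cutSqrt_sq 1
      simpa using this
    rw [ContinuousAt, h1, tendsto_zero_iff_norm_tendsto_zero]
    have h2 : ∀ x, ‖cutSqrt x‖ = √ ‖1 - x ^ 2‖ := fun x => by
      rw [← cutSqrt_sq, norm_pow, Real.sqrt_sq (norm_nonneg _)]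
    simp_rw [h2]
    have : Continuous fun x : ℂ => √ ‖1 - x ^ 2‖ := by fun_prop
    simpa using this.tendsto 1
  · refine (hasDerivAt_cutSqrt ⟨ha, ?_⟩).continuousAt
    by_contra! hcon
    obtain ⟨h1, h2, h3⟩ := hcon
    have him : a.im = 0 := le_antisymm ha' h2
    apply h
    apply Complex.ext
    · simp only [Complex.one_re]
      by_contra hne
      have := h3 (lt_of_le_of_ne h1 (Ne.symm hne))
      linarith
    · simpa using him

theorem sub_cos_ne_zero {a : ℂ} (ha : a.im < 0) (t : ℝ) : a - Real.cos t ≠ 0 := by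
  intro h
  have := congrArg Complex.im h
  simp only [Complex.sub_im, Complex.ofReal_im, Complex.zero_im] at this
  linarith

theorem integral_neg_pi_pi_comp_neg (f : ℝ → ℂ) :
    ∫ t in (-Real.pi)..Real.pi, f (-t) = ∫ t in (-Real.pi)..Real.pi, f t := by
  rw [intervalIntegral.integral_comp_neg, neg_neg]

theorem poisson_integrand_eq {a l w : ℂ} (n : ℕ) (hw : w ≠ 0) (hwl : w - l ≠ 0)
    (hlw : 1 - l * w ≠ 0) (ha : a - (w + w⁻¹) / 2 ≠ 0) (hal : l * (2 * a) = l ^ 2 + 1) :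
    w ^ n / (a - (w + w⁻¹) / 2) =
      (2 * l / Complex.I) * (w * Complex.I * ((w - l)⁻¹ * (w ^ n / (1 - l * w)))) := by
  have key : 2 * l * w * (a - (w + w⁻¹) / 2) = (w - l) * (1 - l * w) := by
    have : w * w⁻¹ = 1 := mul_inv_cancel₀ hw
    linear_combination w * hal - l * this
  have hI := Complex.I_ne_zero
  have hlw' : 1 - w * l ≠ 0 := by rwa [mul_comm]
  rw [div_eq_iff ha]
  calc w ^ n = (w - l) * (1 - l * w) * w ^ n * ((w - l)⁻¹ * (1 - l * w)⁻¹) := by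
        field_simp
    _ = _ := by
        rw [← key]
        have : w * (w - l)⁻¹ * (1 - l * w)⁻¹ = w * ((w - l)⁻¹ * (1 - l * w)⁻¹) := by ring
        rw [div_eq_mul_inv, div_eq_mul_inv]
        linear_combination (-(2 * l * w ^ n * (w * ((w - l)⁻¹ * (1 - l * w)⁻¹)) *
          (a - (w + w⁻¹) / 2))) * mul_inv_cancel₀ hI

theorem integral_exp_div_sub_cos_of_root {a l R : ℂ} (h2 : a.im < 0) (hl : ‖l‖ < 1) (hl0 : l ≠ 0)
    (hR : R ≠ 0) (hal : l * (2 * a) = l ^ 2 + 1) (hlR : l ^ 2 - 1 = 2 * Complex.I * R * l)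
    (n : ℕ) :
    ∫ t in (-Real.pi)..Real.pi, Complex.exp (-Complex.I * (t * n)) / (a - Real.cos t) =
      2 * Real.pi * (l ^ n * (Complex.I / R)) := by
  have hden : ∀ z ∈ Metric.closedBall (0 : ℂ) 1, 1 - l * z ≠ 0 := by
    intro z hz h0
    have hz' : ‖z‖ ≤ 1 := by simpa using hz
    have : ‖l * z‖ < 1 := by
      rw [norm_mul]; nlinarith [norm_nonneg l, norm_nonneg z]
    rw [← sub_eq_zero.1 h0, norm_one] at this
    exact lt_irrefl _ this
  have hd : DifferentiableOn ℂ (fun z : ℂ => z ^ n / (1 - l * z)) (Metric.closedBall 0 1) :=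
    DifferentiableOn.div (by fun_prop) (by fun_prop) hden
  have hw : l ∈ Metric.ball (0 : ℂ) 1 := by rwa [mem_ball_zero_iff]
  have hcauchy : (∮ z in C(0, 1), (z - l)⁻¹ • (z ^ n / (1 - l * z))) =
      (2 * Real.pi * Complex.I : ℂ) • (l ^ n / (1 - l * l)) :=
    hd.circleIntegral_sub_inv_smul hw
  have hper : Function.Periodic
      (fun t : ℝ => Complex.exp (Complex.I * (t * n)) / (a - Real.cos t)) (2 * Real.pi) := by
    intro t
    have : Complex.I * (((t + 2 * Real.pi : ℝ) : ℂ) * n) =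
        Complex.I * (t * n) + n * (2 * Real.pi * Complex.I) := by push_cast; ring
    simp only [this, Complex.exp_add, Complex.exp_nat_mul_two_pi_mul_I, mul_one,
      Real.cos_add_two_pi]
  rw [← integral_neg_pi_pi_comp_neg]
  have hE : (∫ t in (-Real.pi)..Real.pi,
      Complex.exp (-Complex.I * ((-t : ℝ) * n)) / (a - Real.cos (-t))) =
      ∫ t in (0 : ℝ)..(2 * Real.pi), Complex.exp (Complex.I * (t * n)) / (a - Real.cos t) := by
    have := hper.intervalIntegral_add_eq (-Real.pi) 0
    rw [zero_add, show -Real.pi + 2 * Real.pi = Real.pi by ring] at this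
    rw [← this]
    refine intervalIntegral.integral_congr fun t _ => ?_
    simp only [Real.cos_neg]
    congr 2
    push_cast; ring
  rw [hE]
  have hF : ∀ t : ℝ, Complex.exp (Complex.I * (t * n)) / (a - Real.cos t) =
      (2 * l / Complex.I) * (deriv (circleMap 0 1) t • ((circleMap 0 1 t - l)⁻¹ •
        (circleMap 0 1 t ^ n / (1 - l * circleMap 0 1 t)))) := by
    intro t
    have hw : circleMap 0 1 t = Complex.exp (t * Complex.I) := by simp [circleMap]
    have hwn : Complex.exp (Complex.I * (t * n)) = circleMap 0 1 t ^ n := by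
      rw [hw, ← Complex.exp_nat_mul]; congr 1; ring
    have hw0 : circleMap 0 1 t ≠ 0 := by rw [hw]; exact Complex.exp_ne_zero _
    have hcos : (Real.cos t : ℂ) = (circleMap 0 1 t + (circleMap 0 1 t)⁻¹) / 2 := by
      rw [hw, Complex.ofReal_cos, Complex.cos, ← Complex.exp_neg, neg_mul]
    have hne := sub_cos_ne_zero h2 t
    have hd1 := hden (circleMap 0 1 t) (circleMap_mem_closedBall _ zero_le_one _)
    have hd2 : circleMap 0 1 t - l ≠ 0 := by
      intro h0
      have : ‖circleMap 0 1 t‖ = 1 := by simp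
      rw [sub_eq_zero.1 h0] at this
      linarith
    rw [deriv_circleMap, hwn]
    simp only [smul_eq_mul]
    rw [hcos] at hne ⊢
    exact poisson_integrand_eq n hw0 hd2 hd1 hne hal
  simp_rw [hF]
  rw [intervalIntegral.integral_const_mul]
  have hC : (∫ t in (0 : ℝ)..(2 * Real.pi), deriv (circleMap 0 1) t • ((circleMap 0 1 t - l)⁻¹ •
        (circleMap 0 1 t ^ n / (1 - l * circleMap 0 1 t)))) =
      (2 * Real.pi * Complex.I : ℂ) • (l ^ n / (1 - l * l)) := hcauchy
  rw [hC, smul_eq_mul]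
  have h1l : 1 - l * l ≠ 0 := hden l (by simpa using hl.le)
  have hI := Complex.I_ne_zero
  have e3 : 1 - l * l = -(2 * Complex.I * R * l) := by rw [← hlR]; ring
  rw [e3]
  field_simp
  linear_combination (-(1 : ℂ)) * Complex.I_sq

theorem integral_exp_div_sub_cos {a : ℂ} (h1 : -1 < a.re) (h2 : a.im < 0) (n : ℕ) :
    ∫ t in (-Real.pi)..Real.pi, Complex.exp (-Complex.I * (t * n)) / (a - Real.cos t) =
      2 * Real.pi * (joukowski a ^ n * (Complex.I / cutSqrt a)) := by
  have e1 := joukowski_mul a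
  have e2 : joukowski a = a + Complex.I * cutSqrt a := rfl
  refine integral_exp_div_sub_cos_of_root h2 (norm_joukowski_lt_one h1 (Or.inl h2))
    (joukowski_ne_zero a) (cutSqrt_ne_zero ⟨h1, Or.inr (Or.inl h2)⟩) ?_ ?_ n
  · linear_combination e1 - joukowski a * e2
  · linear_combination e1 + joukowski a * e2

theorem latticeGreen_swap (z : ℂ) (x₁ x₂ : ℤ) : latticeGreen z x₁ x₂ = latticeGreen z x₂ x₁ := by
  unfold latticeGreen
  congr 1
  have h := (Measure.measurePreserving_swap (μ := (volume : Measure ℝ))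
    (ν := (volume : Measure ℝ))).setIntegral_preimage_emb
    (MeasurableEquiv.prodComm (α := ℝ) (β := ℝ)).measurableEmbedding
    (fun k : ℝ × ℝ => Complex.exp (-Complex.I * ((k.1 : ℂ) * (x₁ : ℂ) + (k.2 : ℂ) * (x₂ : ℂ))) /
        (((2 - Real.cos k.1 - Real.cos k.2 : ℝ) : ℂ) - z))
    (Set.Icc ((-Real.pi, -Real.pi) : ℝ × ℝ) ((Real.pi, Real.pi) : ℝ × ℝ))
  rw [show (volume : Measure (ℝ × ℝ)) = volume.prod volume from rfl, ← h]
  have hs : (Prod.swap : ℝ × ℝ → ℝ × ℝ) ⁻¹'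
      (Set.Icc ((-Real.pi, -Real.pi) : ℝ × ℝ) ((Real.pi, Real.pi) : ℝ × ℝ)) =
      Set.Icc ((-Real.pi, -Real.pi) : ℝ × ℝ) ((Real.pi, Real.pi) : ℝ × ℝ) := by
    ext ⟨x, y⟩
    simp [Prod.le_def]
    tauto
  rw [hs]
  refine integral_congr_ae (Filter.Eventually.of_forall fun k => ?_)
  simp only [Prod.fst_swap, Prod.snd_swap]
  congr 2
  · ring
  · push_cast; ring

/-- Integrating out the first momentum by residues. -/
theorem latticeGreen_eq_integral (e ε : ℝ) (he : e < 2) (hε : 0 < ε) (m n : ℕ) :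
    latticeGreen ((e : ℂ) + ε * Complex.I) m n =
      (2 * Real.pi)⁻¹ * ∫ t in (-Real.pi)..Real.pi,
        Complex.exp (Complex.I * n * t) *
          joukowski (2 - e - Complex.cos t - ε * Complex.I) ^ m *
          (Complex.I / cutSqrt (2 - e - Complex.cos t - ε * Complex.I)) := by
  have hpi := Real.pi_pos
  set A : ℝ → ℂ := fun t => 2 - e - Complex.cos t - ε * Complex.I with hA
  change _ = ((2 * Real.pi)⁻¹ : ℝ) * ∫ t in (-Real.pi)..Real.pi,
    Complex.exp (Complex.I * n * t) * joukowski (A t) ^ m * (Complex.I / cutSqrt (A t))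
  have hAre : ∀ t, (A t).re = 2 - e - Real.cos t := fun t => by
    simp [hA, ← Complex.ofReal_cos]
  have hAim : ∀ t, (A t).im = -ε := fun t => by
    simp [hA, ← Complex.ofReal_cos]
  have hden : ∀ k : ℝ × ℝ, (((2 - Real.cos k.1 - Real.cos k.2 : ℝ) : ℂ) - (e + ε * Complex.I)) =
      A k.2 - Real.cos k.1 := fun k => by
    simp only [hA]; push_cast; ring
  have hne : ∀ k : ℝ × ℝ, A k.2 - Real.cos k.1 ≠ 0 := fun k =>
    sub_cos_ne_zero (by rw [hAim]; linarith) _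
  have hS : Set.Icc ((-Real.pi, -Real.pi) : ℝ × ℝ) ((Real.pi, Real.pi) : ℝ × ℝ) =
      Set.Icc (-Real.pi) Real.pi ×ˢ Set.Icc (-Real.pi) Real.pi := by
    rw [Set.Icc_prod_Icc]
  have hcont : Continuous fun k : ℝ × ℝ =>
      Complex.exp (-Complex.I * ((k.1 : ℂ) * ((m : ℤ) : ℂ) + (k.2 : ℂ) * ((n : ℤ) : ℂ))) /
        (A k.2 - Real.cos k.1) := by
    refine Continuous.div (by fun_prop) ?_ hne
    simp only [hA]; fun_prop
  have hintg : IntegrableOn (fun k : ℝ × ℝ =>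
      Complex.exp (-Complex.I * ((k.1 : ℂ) * ((m : ℤ) : ℂ) + (k.2 : ℂ) * ((n : ℤ) : ℂ))) /
        (A k.2 - Real.cos k.1))
      (Set.Icc (-Real.pi) Real.pi ×ˢ Set.Icc (-Real.pi) Real.pi) (volume.prod volume) := by
    have := hcont.continuousOn.integrableOn_compact (μ := (volume : Measure (ℝ × ℝ)))
      (isCompact_Icc.prod isCompact_Icc : IsCompact
        (Set.Icc (-Real.pi) Real.pi ×ˢ Set.Icc (-Real.pi) Real.pi))
    exact this
  unfold latticeGreen
  simp_rw [hden]
  rw [hS, show (volume : Measure (ℝ × ℝ)) = volume.prod volume from rfl]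
  rw [IntegrableOn, ← Measure.prod_restrict] at hintg
  rw [← Measure.prod_restrict, integral_prod_symm _ hintg]
  have hinner : ∀ t : ℝ, (∫ x in Set.Icc (-Real.pi) Real.pi,
      Complex.exp (-Complex.I * ((x : ℂ) * ((m : ℤ) : ℂ) + (t : ℂ) * ((n : ℤ) : ℂ))) /
        (A t - Real.cos x)) = 2 * Real.pi * (Complex.exp (-Complex.I * n * t) *
          joukowski (A t) ^ m * (Complex.I / cutSqrt (A t))) := by
    intro t
    rw [integral_Icc_eq_integral_Ioc, ← intervalIntegral.integral_of_le (by linarith)]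
    have h1 := integral_exp_div_sub_cos (a := A t)
      (by rw [hAre]; linarith [Real.cos_le_one t]) (by rw [hAim]; linarith) m
    have h2 : ∀ x : ℝ,
        Complex.exp (-Complex.I * ((x : ℂ) * ((m : ℤ) : ℂ) + (t : ℂ) * ((n : ℤ) : ℂ))) /
        (A t - Real.cos x) = Complex.exp (-Complex.I * n * t) *
          (Complex.exp (-Complex.I * (x * m)) / (A t - Real.cos x)) := fun x => by
      rw [mul_add, Complex.exp_add, ← mul_div_assoc]
      congr 1
      rw [mul_comm]
      congr 2
      push_cast; ring
    simp_rw [h2]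
    rw [intervalIntegral.integral_const_mul, h1]
    ring
  simp only [hinner]
  rw [integral_Icc_eq_integral_Ioc, ← intervalIntegral.integral_of_le (by linarith),
    intervalIntegral.integral_const_mul, ← integral_neg_pi_pi_comp_neg, Complex.real_smul]
  have hA' : ∀ t : ℝ, A (-t) = A t := fun t => by simp [hA]
  have hfin : ∀ t : ℝ, Complex.exp (-Complex.I * n * ((-t : ℝ) : ℂ)) * joukowski (A (-t)) ^ m *
      (Complex.I / cutSqrt (A (-t))) = Complex.exp (Complex.I * n * t) * joukowski (A t) ^ m *
      (Complex.I / cutSqrt (A t)) := fun t => by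
    rw [hA']
    congr 3
    push_cast; ring
  simp_rw [hfin]
  have : (Real.pi : ℂ) ≠ 0 := by exact_mod_cast hpi.ne'
  generalize (∫ t in (-Real.pi)..Real.pi, Complex.exp (Complex.I * n * t) *
    joukowski (A t) ^ m * (Complex.I / cutSqrt (A t))) = X
  push_cast
  field_simp

theorem integral_comp_affine_of_hasDerivAt {F G : ℂ → ℂ} {S : Set ℂ}
    (hG : ∀ z ∈ S, HasDerivAt G (F z) z) (hF : ContinuousOn F S) (p q : ℂ) {α β : ℝ} (hαβ : α ≤ β)
    (hS : ∀ s ∈ Set.Icc α β, p + q * s ∈ S) :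
    q * ∫ s in α..β, F (p + q * s) = G (p + q * β) - G (p + q * α) := by
  rw [← intervalIntegral.integral_const_mul]
  refine intervalIntegral.integral_eq_sub_of_hasDerivAt (f := fun s : ℝ => G (p + q * s)) ?_ ?_
  · intro s hs
    rw [Set.uIcc_of_le hαβ] at hs
    have h1 := hG _ (hS s hs)
    have h2 : HasDerivAt (fun s : ℝ => p + q * (s : ℂ)) q s := by
      have := ((hasDerivAt_id (s : ℂ)).const_mul q).const_add p
      simpa using this.comp_ofReal
    have := h1.comp s h2
    rwa [mul_comm] at this
  · refine ContinuousOn.intervalIntegrable ?_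
    rw [Set.uIcc_of_le hαβ]
    refine continuousOn_const.mul (hF.comp (by fun_prop) hS)

/-- Deformation of the segment `[lo, hi]` to the polygonal path through `lo`, `lo + iδ`,
`b - δ + iδ`, `b + δ - iδ`, `hi - iδ`, `hi`. -/
theorem integral_eq_polygonal {F : ℂ → ℂ} {lo hi b δ ρ : ℝ} (hδ : 0 < δ) (hρ : 2 * δ < ρ)
    (hlo : lo ≤ b - δ) (hhi : b + δ ≤ hi) (hreal : Continuous fun t : ℝ => F t)
    (hL : ∀ k : ℂ, lo ≤ k.re → k.re ≤ b - δ → 0 ≤ k.im → k.im ≤ δ → DifferentiableAt ℂ F k)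
    (hR : ∀ k : ℂ, b + δ ≤ k.re → k.re ≤ hi → -δ ≤ k.im → k.im ≤ 0 → DifferentiableAt ℂ F k)
    (hM : ∀ k ∈ Metric.ball (b : ℂ) ρ, DifferentiableAt ℂ F k) :
    ∫ t in lo..hi, F t =
      Complex.I * (∫ s in (0 : ℝ)..δ, F (lo + s * Complex.I)) +
      (∫ t in lo..(b - δ), F (t + δ * Complex.I)) +
      (1 - Complex.I) * (∫ u in (-δ)..δ, F (b + (1 - Complex.I) * u)) +
      (∫ t in (b + δ)..hi, F (t - δ * Complex.I)) +
      Complex.I * (∫ s in (-δ)..0, F (hi + s * Complex.I)) := by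
  have hML : DifferentiableOn ℂ F (Metric.ball (b : ℂ) ρ) :=
    fun k hk => (hM k hk).differentiableWithinAt
  obtain ⟨G, hG⟩ := hML.isExactOn_ball
  have hmem : ∀ x y : ℝ, |x| ≤ δ → |y| ≤ δ → ((b + x : ℝ) : ℂ) + y * Complex.I ∈
      Metric.ball (b : ℂ) ρ := by
    intro x y hx hy
    rw [mem_ball_iff_norm]
    have : ((b + x : ℝ) : ℂ) + y * Complex.I - b = x + y * Complex.I := by push_cast; ring
    rw [this]
    calc ‖(x : ℂ) + y * Complex.I‖ ≤ ‖(x : ℂ)‖ + ‖(y : ℂ) * Complex.I‖ := norm_add_le _ _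
      _ = |x| + |y| := by simp
      _ < ρ := by linarith
  have hseg := integral_comp_affine_of_hasDerivAt hG hML.continuousOn
  have i1 := hseg 0 1 (α := b - δ) (β := b + δ) (by linarith) (fun s hs => by
    have := hmem (s - b) 0 (abs_le.2 ⟨by linarith [hs.1], by linarith [hs.2]⟩)
      (by simpa using hδ.le)
    convert this using 1
    push_cast; ring)
  have i2 := hseg ((b - δ : ℝ) : ℂ) Complex.I (α := 0) (β := δ) hδ.le (fun s hs => by
    have := hmem (-δ) s (by rw [abs_neg, abs_of_pos hδ]) (abs_le.2 ⟨by linarith [hs.1], hs.2⟩)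
    convert this using 1
    push_cast; ring)
  have i3 := hseg ((b + δ : ℝ) : ℂ) Complex.I (α := -δ) (β := 0) (by linarith) (fun s hs => by
    have := hmem δ s (by rw [abs_of_pos hδ]) (abs_le.2 ⟨hs.1, by linarith [hs.2]⟩)
    convert this using 1
    push_cast; ring)
  have i4 := hseg (b : ℂ) (1 - Complex.I) (α := -δ) (β := δ) (by linarith) (fun s hs => by
    have := hmem s (-s) (abs_le.2 hs) (by rw [abs_neg]; exact abs_le.2 hs)
    convert this using 1
    push_cast; ring)
  have r1 := Complex.integral_boundary_rect_eq_zero_of_differentiableOn F (lo : ℂ)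
    ((b - δ : ℝ) + δ * Complex.I) (fun k hk => by
      rw [Complex.mem_reProdIm] at hk
      obtain ⟨h1, h2⟩ := hk
      simp only [Complex.ofReal_re, Complex.ofReal_im, Complex.add_re, Complex.add_im,
        Complex.mul_re, Complex.mul_im, Complex.I_re, Complex.I_im, mul_zero, mul_one, zero_add,
        add_zero, sub_self] at h1 h2
      rw [Set.uIcc_of_le hlo] at h1
      rw [Set.uIcc_of_le hδ.le] at h2
      exact (hL k h1.1 h1.2 h2.1 h2.2).differentiableWithinAt)
  have r2 := Complex.integral_boundary_rect_eq_zero_of_differentiableOn F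
    ((b + δ : ℝ) + (-δ : ℝ) * Complex.I) (hi : ℂ) (fun k hk => by
      rw [Complex.mem_reProdIm] at hk
      obtain ⟨h1, h2⟩ := hk
      simp only [Complex.ofReal_re, Complex.ofReal_im, Complex.add_re, Complex.add_im,
        Complex.mul_re, Complex.mul_im, Complex.I_re, Complex.I_im, mul_zero, mul_one, zero_add,
        add_zero, sub_self] at h1 h2
      rw [Set.uIcc_of_le hhi] at h1
      rw [Set.uIcc_of_le (by linarith)] at h2
      exact (hR k h1.1 h1.2 h2.1 h2.2).differentiableWithinAt)
  simp only [Complex.ofReal_re, Complex.ofReal_im, Complex.add_re, Complex.add_im,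
    Complex.mul_re, Complex.mul_im, Complex.I_re, Complex.I_im, mul_zero, mul_one, zero_add,
    add_zero, sub_self, zero_mul, Complex.ofReal_zero, smul_eq_mul] at r1 r2
  have hintg : ∀ x y, IntervalIntegrable (fun t : ℝ => F t) volume x y :=
    fun x y => hreal.intervalIntegrable x y
  rw [← intervalIntegral.integral_add_adjacent_intervals (hintg lo (b - δ)) (hintg (b - δ) hi),
    ← intervalIntegral.integral_add_adjacent_intervals (hintg (b - δ) (b + δ)) (hintg (b + δ) hi)]
  have c1 : ∀ x y : ℂ, x - (y : ℂ) * Complex.I = x + (-y) * Complex.I := fun x y => by ring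
  simp only [mul_comm Complex.I, c1] at *
  simp only [zero_add, one_mul] at i1
  have e1 : ((b - δ : ℝ) : ℂ) + δ * Complex.I = b + (1 - Complex.I) * ((-δ : ℝ) : ℂ) := by
    push_cast; ring
  have e2 : ((b + δ : ℝ) : ℂ) + ((-δ : ℝ) : ℂ) * Complex.I = b + (1 - Complex.I) * (δ : ℂ) := by
    push_cast; ring
  rw [e1] at i2
  rw [e2] at i3
  simp only [Complex.ofReal_zero, zero_mul, add_zero, Complex.ofReal_neg] at i2 i3 i4 r2 ⊢
  linear_combination r1 - r2 + i1 - i2 - i3 - i4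

open Filter Topology in
theorem tendsto_integral_of_continuousOn {f : ℝ → ℝ → ℂ} {α β : ℝ}
    (hf : ContinuousOn (Function.uncurry f) (Set.Icc 0 1 ×ˢ Set.uIcc α β)) :
    Tendsto (fun ε => ∫ s in α..β, f ε s) (𝓝[>] 0) (𝓝 (∫ s in α..β, f 0 s)) := by
  obtain ⟨C, hC⟩ := (isCompact_Icc.prod isCompact_uIcc).exists_bound_of_continuousOn hf
  have hev : ∀ᶠ ε : ℝ in 𝓝[>] 0, ε ∈ Set.Icc (0 : ℝ) 1 := by
    filter_upwards [Ioo_mem_nhdsGT (zero_lt_one (α := ℝ))] with ε hε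
    exact ⟨hε.1.le, hε.2.le⟩
  refine intervalIntegral.tendsto_integral_filter_of_dominated_convergence (fun _ => C) ?_ ?_
    intervalIntegrable_const ?_
  · filter_upwards [hev] with ε hε
    have : ContinuousOn (f ε) (Set.uIcc α β) :=
      hf.comp (f := fun s => (ε, s)) (by fun_prop) (fun s hs => ⟨hε, hs⟩)
    exact (this.mono Set.uIoc_subset_uIcc).aestronglyMeasurable measurableSet_uIoc
  · filter_upwards [hev] with ε hε
    exact Eventually.of_forall fun s hs => hC (ε, s) ⟨hε, Set.uIoc_subset_uIcc hs⟩
  · refine Eventually.of_forall fun s hs => ?_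
    have h1 : ContinuousWithinAt (Function.uncurry f) (Set.Icc 0 1 ×ˢ Set.uIcc α β) (0, s) :=
      hf (0, s) ⟨⟨le_rfl, zero_le_one⟩, Set.uIoc_subset_uIcc hs⟩
    have h2 : Tendsto (fun ε : ℝ => (ε, s)) (𝓝[>] 0)
        (𝓝[Set.Icc 0 1 ×ˢ Set.uIcc α β] (0, s)) := by
      refine tendsto_nhdsWithin_iff.2 ⟨?_, ?_⟩
      · exact ((Continuous.prodMk_left s).tendsto 0).mono_left nhdsWithin_le_nhds
      · filter_upwards [hev] with ε hε using ⟨hε, Set.uIoc_subset_uIcc hs⟩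
    exact h1.tendsto.comp h2

open Filter Topology Asymptotics in
/-- Laplace's method at an interior quadratic maximum. -/
theorem tendsto_sqrt_mul_integral_pow {h B : ℝ → ℂ} {κ δ : ℝ} (hκ : 0 < κ) (hδ : 0 < δ)
    (hc : ContinuousOn h (Set.Icc (-δ) δ)) (hB : ContinuousOn B (Set.Icc (-δ) δ))
    (hb : ∀ u ∈ Set.Icc (-δ) δ, ‖h u‖ ≤ 1 - κ / 2 * u ^ 2)
    (hlim : (fun u : ℝ => h u - (1 - κ * u ^ 2)) =o[𝓝 0] (fun u : ℝ => u ^ 2)) :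
    Tendsto (fun j : ℕ => (√(j : ℝ) : ℂ) * ∫ u in (-δ)..δ, h u ^ j * B u) atTop
      (𝓝 (B 0 * (√(Real.pi / κ) : ℝ))) := by
  obtain ⟨C, hC⟩ := isCompact_Icc.exists_bound_of_continuousOn hB
  set g : ℕ → ℝ → ℂ := fun j => (Set.Ioc (-δ * √(j : ℝ)) (δ * √(j : ℝ))).indicator
    (fun v => h (v / √(j : ℝ)) ^ j * B (v / √(j : ℝ))) with hg
  have hmem : ∀ {j : ℕ}, 0 < j → ∀ v ∈ Set.Ioc (-δ * √(j : ℝ)) (δ * √(j : ℝ)),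
      v / √(j : ℝ) ∈ Set.Icc (-δ) δ := by
    intro j hj v hv
    have hs : 0 < √(j : ℝ) := Real.sqrt_pos.2 (by exact_mod_cast hj)
    exact ⟨(le_div_iff₀ hs).2 hv.1.le, (div_le_iff₀ hs).2 hv.2⟩
  have hres : ∀ᶠ j : ℕ in atTop,
      ∫ v, g j v = (√(j : ℝ) : ℂ) * ∫ u in (-δ)..δ, h u ^ j * B u := by
    filter_upwards [eventually_gt_atTop 0] with j hj
    have hs : 0 < √(j : ℝ) := Real.sqrt_pos.2 (by exact_mod_cast hj)
    have h1 := intervalIntegral.integral_comp_div (a := -δ * √(j : ℝ)) (b := δ * √(j : ℝ))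
      (fun u => h u ^ j * B u) hs.ne'
    rw [mul_div_cancel_right₀ _ hs.ne', mul_div_cancel_right₀ _ hs.ne', Complex.real_smul] at h1
    rw [← h1, hg, integral_indicator measurableSet_Ioc,
      intervalIntegral.integral_of_le (by nlinarith)]
  refine Tendsto.congr' hres ?_
  have htarget : (B 0 * (√(Real.pi / κ) : ℝ) : ℂ) =
      ∫ v : ℝ, Complex.exp (-(κ * v ^ 2 : ℝ)) * B 0 := by
    rw [integral_mul_const, ← integral_gaussian κ, ← integral_complex_ofReal, mul_comm]
    congr 2
    ext v
    push_cast
    ring_nf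
  rw [htarget]
  refine tendsto_integral_filter_of_dominated_convergence
    (fun v => Real.exp (-(κ / 2) * v ^ 2) * C) ?_ ?_
    ((integrable_exp_neg_mul_sq (by positivity)).mul_const C) ?_
  · filter_upwards [eventually_gt_atTop 0] with j hj
    refine (aestronglyMeasurable_indicator_iff measurableSet_Ioc).2 ?_
    refine ContinuousOn.aestronglyMeasurable ?_ measurableSet_Ioc
    exact ((hc.comp (by fun_prop) (hmem hj)).pow j).mul (hB.comp (by fun_prop) (hmem hj))
  · filter_upwards [eventually_gt_atTop 0] with j hj
    refine Eventually.of_forall fun v => ?_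
    have hC0 : 0 ≤ C := (norm_nonneg _).trans (hC 0 ⟨by linarith, hδ.le⟩)
    by_cases hv : v ∈ Set.Ioc (-δ * √(j : ℝ)) (δ * √(j : ℝ))
    swap
    · rw [hg]
      simp only [Set.indicator_of_notMem hv, norm_zero]
      positivity
    rw [hg]
    simp only [Set.indicator_of_mem hv]
    have hj' : (0 : ℝ) < j := by exact_mod_cast hj
    have hm := hmem hj v hv
    rw [norm_mul, norm_pow]
    refine mul_le_mul ?_ (hC _ hm) (norm_nonneg _) (Real.exp_pos _).le
    have h1 := (hb _ hm).trans (Real.one_sub_le_exp_neg _)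
    refine (pow_le_pow_left₀ (norm_nonneg _) h1 j).trans ?_
    rw [← Real.exp_nat_mul, div_pow, Real.sq_sqrt hj'.le]
    apply le_of_eq
    congr 1
    field_simp
  · refine Eventually.of_forall fun v => ?_
    have hsq : Tendsto (fun j : ℕ => √(j : ℝ)) atTop atTop :=
      Real.tendsto_sqrt_atTop.comp tendsto_natCast_atTop_atTop
    have hv0 : Tendsto (fun j : ℕ => v / √(j : ℝ)) atTop (𝓝 0) := hsq.const_div_atTop v
    have hin : ∀ᶠ j : ℕ in atTop, g j v = h (v / √(j : ℝ)) ^ j * B (v / √(j : ℝ)) := by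
      filter_upwards [hv0 (Ioo_mem_nhds (neg_lt_zero.2 hδ) hδ), eventually_gt_atTop 0] with j hj hj0
      have hs : 0 < √(j : ℝ) := Real.sqrt_pos.2 (by exact_mod_cast hj0)
      have hv : v ∈ Set.Ioc (-δ * √(j : ℝ)) (δ * √(j : ℝ)) :=
        ⟨(lt_div_iff₀ hs).1 hj.1, ((div_lt_iff₀ hs).1 hj.2).le⟩
      exact Set.indicator_of_mem hv _
    refine Tendsto.congr' (EventuallyEq.symm hin) (Tendsto.mul ?_ ?_)
    · have h1 : ∀ j : ℕ, h (v / √(j : ℝ)) ^ j = (1 + (h (v / √(j : ℝ)) - 1)) ^ j :=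
        fun j => by ring
      simp_rw [h1]
      apply Complex.tendsto_one_add_pow_exp_of_tendsto
      have h2 : Tendsto (fun j : ℕ => (j : ℂ) * (h (v / √(j : ℝ)) -
          (1 - κ * ((v / √(j : ℝ) : ℝ) : ℂ) ^ 2))) atTop (𝓝 0) := by
        rw [← isLittleO_one_iff ℝ]
        have h0 : (fun j : ℕ => (j : ℂ)) =O[atTop] (fun j : ℕ => (j : ℝ)) :=
          IsBigO.of_bound 1 (by simp)
        have h3 := h0.mul_isLittleO (hlim.comp_tendsto hv0)
        refine h3.trans_isBigO (IsBigO.of_bound (v ^ 2) ?_)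
        filter_upwards [eventually_gt_atTop 0] with j hj0
        have hj' : (0 : ℝ) < j := by exact_mod_cast hj0
        simp only [Function.comp_apply, norm_mul, norm_pow, norm_div,
          Real.norm_eq_abs, Nat.abs_cast, norm_one, mul_one, div_pow, sq_abs, Real.sq_sqrt hj'.le]
        apply le_of_eq
        field_simp
      have h4 := h2.sub_const ((κ * v ^ 2 : ℝ) : ℂ)
      rw [zero_sub] at h4
      refine h4.congr' ?_
      filter_upwards [eventually_gt_atTop 0] with j hj0
      have hj' : (0 : ℝ) < j := by exact_mod_cast hj0
      have h5 : (j : ℂ) * ((v / √(j : ℝ) : ℝ) : ℂ) ^ 2 = (v : ℂ) ^ 2 := by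
        rw [← Complex.ofReal_pow, div_pow, Real.sq_sqrt hj'.le]
        push_cast
        have : (j : ℂ) ≠ 0 := by exact_mod_cast hj0.ne'
        field_simp
      push_cast at h5 ⊢
      linear_combination (κ : ℂ) * h5
    · exact ((hB.continuousAt (Icc_mem_nhds (neg_lt_zero.2 hδ) hδ)).tendsto).comp hv0

/-- The value of the cosine of the second quasi-momentum at first quasi-momentum `k`, at
energy `2 - c + iε`. -/
noncomputable def shellCos (c ε : ℝ) (k : ℂ) : ℂ := c - Complex.cos k - ε * Complex.I

theorem shellCos_re (c ε : ℝ) (k : ℂ) :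
    (shellCos c ε k).re = c - Real.cos k.re * Real.cosh k.im := by
  rw [shellCos, Complex.cos_eq]
  simp [← Complex.ofReal_cos, ← Complex.ofReal_sin, ← Complex.ofReal_cosh, ← Complex.ofReal_sinh]

theorem shellCos_im (c ε : ℝ) (k : ℂ) :
    (shellCos c ε k).im = Real.sin k.re * Real.sinh k.im - ε := by
  rw [shellCos, Complex.cos_eq]
  simp [← Complex.ofReal_cos, ← Complex.ofReal_sin, ← Complex.ofReal_cosh, ← Complex.ofReal_sinh]

/-- The wave with first quasi-momentum `k` carried by the lattice vector `(n, m)`. -/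
noncomputable def blochFactor (m n : ℕ) (c ε : ℝ) (k : ℂ) : ℂ :=
  Complex.exp (Complex.I * (n * k)) * joukowski (shellCos c ε k) ^ m

/-- The density of waves on the energy shell. -/
noncomputable def blochAmplitude (c ε : ℝ) (k : ℂ) : ℂ := Complex.I / cutSqrt (shellCos c ε k)

theorem shellCos_mem_branchDomain_left {α β ε : ℝ} (hα : 0 < α) (hβ : 0 ≤ β) (hαβ : α + β < Real.pi)
    (hc : 0 < Real.cos α + Real.cos β) (hcβ : 0 < Real.cos β) (hε : 0 ≤ ε) {k : ℂ}
    (h1 : -Real.pi ≤ k.re)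
    (h2 : k.re ≤ β) (h3 : 0 ≤ k.im) (h4 : Real.cosh k.im < 1 + (Real.cos α + Real.cos β))
    (h5 : 0 < ε ∨ 0 < k.im ∨ k.re = -Real.pi) :
    shellCos (Real.cos α + Real.cos β) ε k ∈ branchDomain := by
  have hcα : Real.cos α < 1 := by
    rw [← Real.cos_zero]
    exact Real.cos_lt_cos_of_nonneg_of_le_pi le_rfl (by linarith) hα
  have hch := Real.one_le_cosh k.im
  refine ⟨?_, ?_⟩
  · rw [shellCos_re]
    nlinarith [Real.cos_le_one k.re]
  rw [shellCos_re, shellCos_im]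
  rcases h1.eq_or_lt with h1 | h1
  · right; right
    rw [← h1, Real.cos_neg, Real.sin_neg, Real.cos_pi, Real.sin_pi]
    constructor <;> linarith
  rcases le_or_gt (-β) k.re with h6 | h6
  · left
    have : Real.cos β ≤ Real.cos k.re := by
      rw [← Real.cos_abs k.re]
      exact Real.cos_le_cos_of_nonneg_of_le_pi (abs_nonneg _) (by linarith) (abs_le.2 ⟨h6, h2⟩)
    nlinarith
  · right; left
    have hs : Real.sin k.re < 0 := Real.sin_neg_of_neg_of_neg_pi_lt (by linarith) h1
    have hsh : 0 ≤ Real.sinh k.im := Real.sinh_nonneg_iff.2 h3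
    rcases h5 with h5 | h5 | h5
    · nlinarith
    · nlinarith [Real.sinh_pos_iff.2 h5]
    · linarith

theorem shellCos_mem_branchDomain_right {α β ε : ℝ} (hα : 0 < α) (hβ : 0 ≤ β)
    (hαβ : α + β < Real.pi) (hc : 0 < Real.cos α + Real.cos β) (hε : 0 ≤ ε) {k : ℂ}
    (h1 : β ≤ k.re) (h2 : k.re ≤ Real.pi) (h3 : k.im ≤ 0)
    (h4 : Real.cosh k.im < 1 + (Real.cos α + Real.cos β))
    (h5 : 0 < ε ∨ k.im < 0 ∨ k.re = Real.pi) :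
    shellCos (Real.cos α + Real.cos β) ε k ∈ branchDomain := by
  have hcα : Real.cos α < 1 := by
    rw [← Real.cos_zero]
    exact Real.cos_lt_cos_of_nonneg_of_le_pi le_rfl (by linarith) hα
  have hch := Real.one_le_cosh k.im
  refine ⟨?_, ?_⟩
  · rw [shellCos_re]
    nlinarith [Real.cos_le_one k.re]
  rw [shellCos_re, shellCos_im]
  rcases h2.eq_or_lt with h2 | h2
  · right; right
    rw [h2, Real.cos_pi, Real.sin_pi]
    constructor <;> linarith
  have hsh : Real.sinh k.im ≤ 0 := Real.sinh_nonpos_iff.2 h3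
  rcases (hβ.trans h1).eq_or_lt with h6 | h6
  · left
    rw [← h6, Real.cos_zero]
    nlinarith [Real.cos_le_one β]
  · right; left
    have hs : 0 < Real.sin k.re := Real.sin_pos_of_pos_of_lt_pi h6 h2
    rcases h5 with h5 | h5 | h5
    · nlinarith
    · nlinarith [Real.sinh_neg_iff.2 h5]
    · linarith

theorem hasDerivAt_shellCos (c ε : ℝ) (k : ℂ) :
    HasDerivAt (shellCos c ε) (Complex.sin k) k := by
  have := ((Complex.hasDerivAt_cos k).const_sub (c : ℂ)).sub_const (ε * Complex.I)
  rwa [neg_neg] at this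

theorem continuous_shellCos (c : ℝ) : Continuous fun p : ℝ × ℂ => shellCos c p.1 p.2 := by
  unfold shellCos
  fun_prop

theorem differentiableAt_blochFactor_pow_mul (m n j : ℕ) {c ε : ℝ} {k : ℂ}
    (hk : shellCos c ε k ∈ branchDomain) :
    DifferentiableAt ℂ (fun k => blochFactor m n c ε k ^ j * blochAmplitude c ε k) k := by
  have h1 := (hasDerivAt_shellCos c ε k).differentiableAt
  have h2 : DifferentiableAt ℂ (fun k => joukowski (shellCos c ε k)) k :=
    (hasDerivAt_joukowski hk).differentiableAt.comp k h1
  have h3 : DifferentiableAt ℂ (fun k => cutSqrt (shellCos c ε k)) k :=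
    (hasDerivAt_cutSqrt hk).differentiableAt.comp k h1
  have h4 := cutSqrt_ne_zero hk
  unfold blochFactor blochAmplitude
  refine DifferentiableAt.mul (DifferentiableAt.pow (DifferentiableAt.mul ?_ (h2.pow m)) j)
    ((differentiableAt_const _).div h3 h4)
  fun_prop

theorem continuousAt_blochFactor (m n : ℕ) {c : ℝ} {p : ℝ × ℂ}
    (hk : shellCos c p.1 p.2 ∈ branchDomain) :
    ContinuousAt (fun p : ℝ × ℂ => blochFactor m n c p.1 p.2) p := by
  have h1 := (continuous_shellCos c).continuousAt (x := p)
  have h2 : ContinuousAt (fun p : ℝ × ℂ => joukowski (shellCos c p.1 p.2)) p :=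
    ContinuousAt.comp (g := joukowski) (hasDerivAt_joukowski hk).continuousAt h1
  unfold blochFactor
  refine ContinuousAt.mul ?_ (h2.pow m)
  fun_prop

theorem continuousAt_blochAmplitude {c : ℝ} {p : ℝ × ℂ}
    (hk : shellCos c p.1 p.2 ∈ branchDomain) :
    ContinuousAt (fun p : ℝ × ℂ => blochAmplitude c p.1 p.2) p := by
  have h1 := (continuous_shellCos c).continuousAt (x := p)
  exact continuousAt_const.div
    (ContinuousAt.comp (g := cutSqrt) (hasDerivAt_cutSqrt hk).continuousAt h1) (cutSqrt_ne_zero hk)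

open Filter Topology in
/-- The integral of a power of a function of modulus less than one decays exponentially. -/
theorem tendsto_sqrt_mul_integral_pow_zero {h B : ℝ → ℂ} {a b : ℝ}
    (hc : ContinuousOn h (Set.uIcc a b)) (hB : ContinuousOn B (Set.uIcc a b))
    (hlt : ∀ u ∈ Set.uIcc a b, ‖h u‖ < 1) :
    Tendsto (fun j : ℕ => (√(j : ℝ) : ℂ) * ∫ u in a..b, h u ^ j * B u) atTop (𝓝 0) := by
  obtain ⟨C, hC⟩ := isCompact_uIcc.exists_bound_of_continuousOn hB
  obtain ⟨u₀, hu₀, hmax⟩ := isCompact_uIcc.exists_isMaxOn Set.nonempty_uIcc hc.norm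
  set r := ‖h u₀‖
  have hr0 : 0 ≤ r := norm_nonneg _
  have hr1 : r < 1 := hlt u₀ hu₀
  have hlim : Tendsto (fun j : ℕ => (j : ℝ) * r ^ j * (C * |b - a|)) atTop (𝓝 0) := by
    simpa using (tendsto_self_mul_const_pow_of_lt_one hr0 hr1).mul_const (C * |b - a|)
  refine squeeze_zero_norm' ?_ hlim
  filter_upwards [eventually_ge_atTop 1] with j hj
  have hj' : (1 : ℝ) ≤ j := by exact_mod_cast hj
  have h1 : ‖∫ u in a..b, h u ^ j * B u‖ ≤ r ^ j * C * |b - a| := by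
    refine intervalIntegral.norm_integral_le_of_norm_le_const fun u hu => ?_
    have hu' := Set.uIoc_subset_uIcc hu
    rw [norm_mul, norm_pow]
    exact mul_le_mul (pow_le_pow_left₀ (norm_nonneg _) (hmax hu') j) (hC u hu') (norm_nonneg _)
      (by positivity)
  rw [norm_mul, Complex.norm_real, Real.norm_eq_abs, abs_of_nonneg (Real.sqrt_nonneg _)]
  calc √(j : ℝ) * ‖∫ u in a..b, h u ^ j * B u‖ ≤ j * (r ^ j * C * |b - a|) :=
        mul_le_mul (Real.sqrt_le_iff.2 ⟨by linarith, by nlinarith⟩) h1 (norm_nonneg _) (by linarith)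
    _ = _ := by ring

open Filter Topology in
theorem tendsto_integral_blochFactor_pow_mul (m n j : ℕ) {c a b : ℝ} {γ : ℝ → ℂ} (hγ : Continuous γ)
    (hdom : ∀ ε ∈ Set.Icc (0 : ℝ) 1, ∀ s ∈ Set.uIcc a b, shellCos c ε (γ s) ∈ branchDomain) :
    Tendsto (fun ε => ∫ s in a..b, blochFactor m n c ε (γ s) ^ j * blochAmplitude c ε (γ s))
      (𝓝[>] 0)
      (𝓝 (∫ s in a..b, blochFactor m n c 0 (γ s) ^ j * blochAmplitude c 0 (γ s))) := by
  refine tendsto_integral_of_continuousOn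
    (f := fun ε s => blochFactor m n c ε (γ s) ^ j * blochAmplitude c ε (γ s)) ?_
  rintro ⟨ε, s⟩ ⟨hε, hs⟩
  have h0 : Continuous fun p : ℝ × ℝ => (p.1, γ p.2) := by fun_prop
  have h1 := hdom ε hε s hs
  have h2 : ContinuousAt (fun p : ℝ × ℝ => blochFactor m n c p.1 (γ p.2)) (ε, s) :=
    ContinuousAt.comp (f := fun p : ℝ × ℝ => (p.1, γ p.2)) (x := (ε, s))
      (continuousAt_blochFactor m n (p := (ε, γ s)) h1) h0.continuousAt
  have h3 : ContinuousAt (fun p : ℝ × ℝ => blochAmplitude c p.1 (γ p.2)) (ε, s) :=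
    ContinuousAt.comp (f := fun p : ℝ × ℝ => (p.1, γ p.2)) (x := (ε, s))
      (continuousAt_blochAmplitude (p := (ε, γ s)) h1) h0.continuousAt
  exact ((h2.pow j).mul h3).continuousWithinAt

open Filter Topology in
theorem tendsto_sqrt_mul_integral_blochFactor_zero (m n : ℕ) {c a b : ℝ} {γ : ℝ → ℂ}
    (hγ : Continuous γ) (hdom : ∀ s ∈ Set.uIcc a b, shellCos c 0 (γ s) ∈ branchDomain)
    (hlt : ∀ s ∈ Set.uIcc a b, ‖blochFactor m n c 0 (γ s)‖ < 1) :
    Tendsto (fun j : ℕ => (√(j : ℝ) : ℂ) *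
      ∫ s in a..b, blochFactor m n c 0 (γ s) ^ j * blochAmplitude c 0 (γ s)) atTop (𝓝 0) := by
  have h0 : Continuous fun s : ℝ => ((0 : ℝ), γ s) := by fun_prop
  refine tendsto_sqrt_mul_integral_pow_zero (fun s hs => ?_) (fun s hs => ?_) hlt
  · exact (ContinuousAt.comp (f := fun s : ℝ => ((0 : ℝ), γ s))
      (continuousAt_blochFactor m n (p := (0, γ s)) (hdom s hs))
      h0.continuousAt).continuousWithinAt
  · exact (ContinuousAt.comp (f := fun s : ℝ => ((0 : ℝ), γ s))
      (continuousAt_blochAmplitude (p := (0, γ s)) (hdom s hs)) h0.continuousAt).continuousWithinAt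

open Filter Topology in
theorem tendsto_sqrt_mul_boundary_value_of_contour {α β e : ℝ} (hα : 0 < α) (hβ : 0 ≤ β)
    (hαβ : α + β < Real.pi) (hc : 0 < Real.cos α + Real.cos β) (hcβ : 0 < Real.cos β)
    (hce : Real.cos α + Real.cos β = 2 - e) (m n : ℕ) {G : ℕ → ℂ}
    (hG : ∀ j : ℕ, Tendsto
      (fun ε : ℝ => latticeGreen ((e : ℂ) + ε * Complex.I) (j * m : ℕ) (j * n : ℕ))
      (𝓝[>] 0) (𝓝 (G j)))
    {δ ρ : ℝ} (hδ : 0 < δ) (hρ : 2 * δ < ρ) (hcosh : Real.cosh δ < 1 + (Real.cos α + Real.cos β))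
    (hlo : -Real.pi ≤ β - δ) (hhi : β + δ ≤ Real.pi)
    (hball : ∀ k ∈ Metric.ball (β : ℂ) ρ, -1 < (shellCos (Real.cos α + Real.cos β) 0 k).re ∧
      (shellCos (Real.cos α + Real.cos β) 0 k).re < 1)
    (hL : ∀ t ∈ Set.Icc (-Real.pi) (β - δ),
      ‖blochFactor m n (Real.cos α + Real.cos β) 0 (t + δ * Complex.I)‖ < 1)
    (hVL : ∀ s ∈ Set.Icc 0 δ,
      ‖blochFactor m n (Real.cos α + Real.cos β) 0 ((-Real.pi : ℝ) + s * Complex.I)‖ < 1)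
    (hR : ∀ t ∈ Set.Icc (β + δ) Real.pi,
      ‖blochFactor m n (Real.cos α + Real.cos β) 0 (t - δ * Complex.I)‖ < 1)
    (hVR : ∀ s ∈ Set.Icc (-δ) 0,
      ‖blochFactor m n (Real.cos α + Real.cos β) 0 ((Real.pi : ℝ) + s * Complex.I)‖ < 1)
    {w L : ℂ} (hw : ‖w‖ = 1) (hdiag : Tendsto (fun j : ℕ => w ^ j * ((√(j : ℝ) : ℂ) *
      ∫ u in (-δ)..δ,
        blochFactor m n (Real.cos α + Real.cos β) 0 (β + (1 - Complex.I) * u) ^ j *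
          blochAmplitude (Real.cos α + Real.cos β) 0 (β + (1 - Complex.I) * u))) atTop (𝓝 L)) :
    Tendsto (fun j : ℕ => w ^ j * ((√(j : ℝ) : ℂ) * G j)) atTop
      (𝓝 ((2 * Real.pi)⁻¹ * ((1 - Complex.I) * L))) := by
  have hcoshle : ∀ s : ℝ, |s| ≤ δ → Real.cosh s < 1 + (Real.cos α + Real.cos β) := by
    intro s hs
    refine lt_of_le_of_lt (Real.cosh_le_cosh.2 ?_) hcosh
    rwa [abs_of_pos hδ]
  set c := Real.cos α + Real.cos β with hcdef
  have hballdom : ∀ ε : ℝ, ∀ k ∈ Metric.ball (β : ℂ) ρ, shellCos c ε k ∈ branchDomain := by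
    intro ε k hk
    obtain ⟨h1, h2⟩ := hball k hk
    rw [shellCos_re] at h1 h2
    exact ⟨by rwa [shellCos_re], Or.inl (by rwa [shellCos_re])⟩
  have hD1 : ∀ ε ∈ Set.Icc (0 : ℝ) 1, ∀ s ∈ Set.uIcc 0 δ,
      shellCos c ε ((-Real.pi : ℝ) + s * Complex.I) ∈ branchDomain := by
    intro ε hε s hs
    rw [Set.uIcc_of_le hδ.le] at hs
    apply shellCos_mem_branchDomain_left hα hβ hαβ hc hcβ hε.1 <;> simp
    · linarith [Real.pi_pos]
    · exact hs.1
    · exact hcoshle s (abs_le.2 ⟨by linarith [hs.1], hs.2⟩)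
  have hD2 : ∀ ε ∈ Set.Icc (0 : ℝ) 1, ∀ t ∈ Set.uIcc (-Real.pi) (β - δ),
      shellCos c ε (t + δ * Complex.I) ∈ branchDomain := by
    intro ε hε t ht
    rw [Set.uIcc_of_le hlo] at ht
    apply shellCos_mem_branchDomain_left hα hβ hαβ hc hcβ hε.1 <;> simp
    · exact ht.1
    · linarith [ht.2]
    · exact hδ.le
    · exact hcosh
    · exact Or.inr (Or.inl hδ)
  have hD3 : ∀ ε ∈ Set.Icc (0 : ℝ) 1, ∀ u ∈ Set.uIcc (-δ) δ,
      shellCos c ε (β + (1 - Complex.I) * u) ∈ branchDomain := by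
    intro ε hε u hu
    rw [Set.uIcc_of_le (by linarith)] at hu
    apply hballdom
    rw [mem_ball_iff_norm, add_sub_cancel_left, norm_mul, Complex.norm_real, Real.norm_eq_abs]
    have h1 : ‖(1 - Complex.I : ℂ)‖ ≤ 2 := by
      refine (norm_sub_le _ _).trans ?_
      norm_num
    nlinarith [abs_le.2 hu, abs_nonneg u]
  have hD4 : ∀ ε ∈ Set.Icc (0 : ℝ) 1, ∀ t ∈ Set.uIcc (β + δ) Real.pi,
      shellCos c ε (t - δ * Complex.I) ∈ branchDomain := by
    intro ε hε t ht
    rw [Set.uIcc_of_le hhi] at ht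
    apply shellCos_mem_branchDomain_right hα hβ hαβ hc hε.1 <;> simp
    · linarith [ht.1]
    · exact ht.2
    · exact hδ.le
    · exact hcosh
    · exact Or.inr (Or.inl hδ)
  have hD5 : ∀ ε ∈ Set.Icc (0 : ℝ) 1, ∀ s ∈ Set.uIcc (-δ) 0,
      shellCos c ε ((Real.pi : ℝ) + s * Complex.I) ∈ branchDomain := by
    intro ε hε s hs
    rw [Set.uIcc_of_le (by linarith)] at hs
    apply shellCos_mem_branchDomain_right hα hβ hαβ hc hε.1 <;> simp
    · linarith
    · exact hs.2
    · exact hcoshle s (abs_le.2 ⟨hs.1, by linarith [hs.2]⟩)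
  have g1 : Continuous fun s : ℝ => ((-Real.pi : ℝ) : ℂ) + s * Complex.I := by fun_prop
  have g2 : Continuous fun t : ℝ => (t : ℂ) + δ * Complex.I := by fun_prop
  have g3 : Continuous fun u : ℝ => (β : ℂ) + (1 - Complex.I) * u := by fun_prop
  have g4 : Continuous fun t : ℝ => (t : ℂ) - δ * Complex.I := by fun_prop
  have g5 : Continuous fun s : ℝ => ((Real.pi : ℝ) : ℂ) + s * Complex.I := by fun_prop
  have hGeq : ∀ j : ℕ, G j = (2 * Real.pi)⁻¹ *
      (Complex.I * (∫ s in (0 : ℝ)..δ, blochFactor m n c 0 ((-Real.pi : ℝ) + s * Complex.I) ^ j *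
        blochAmplitude c 0 ((-Real.pi : ℝ) + s * Complex.I)) +
      (∫ t in (-Real.pi)..(β - δ), blochFactor m n c 0 (t + δ * Complex.I) ^ j *
        blochAmplitude c 0 (t + δ * Complex.I)) +
      (1 - Complex.I) * (∫ u in (-δ)..δ, blochFactor m n c 0 (β + (1 - Complex.I) * u) ^ j *
        blochAmplitude c 0 (β + (1 - Complex.I) * u)) +
      (∫ t in (β + δ)..Real.pi, blochFactor m n c 0 (t - δ * Complex.I) ^ j *
        blochAmplitude c 0 (t - δ * Complex.I)) +
      Complex.I * (∫ s in (-δ)..0, blochFactor m n c 0 ((Real.pi : ℝ) + s * Complex.I) ^ j *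
        blochAmplitude c 0 ((Real.pi : ℝ) + s * Complex.I))) := by
    intro j
    refine tendsto_nhds_unique (hG j) (Tendsto.congr' ?_ ((((((
      (tendsto_integral_blochFactor_pow_mul m n j g1 hD1).const_mul Complex.I).add
      (tendsto_integral_blochFactor_pow_mul m n j g2 hD2)).add
      ((tendsto_integral_blochFactor_pow_mul m n j g3 hD3).const_mul (1 - Complex.I))).add
      (tendsto_integral_blochFactor_pow_mul m n j g4 hD4)).add
      ((tendsto_integral_blochFactor_pow_mul m n j g5 hD5).const_mul Complex.I)).const_mul _))
    filter_upwards [self_mem_nhdsWithin] with ε hε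
    have hε : 0 < ε := hε
    have he : e < 2 := by linarith
    rw [latticeGreen_eq_integral e ε he hε]
    have hintg : ∀ t : ℝ, Complex.exp (Complex.I * (j * n : ℕ) * t) *
          joukowski (2 - e - Complex.cos t - ε * Complex.I) ^ (j * m) *
          (Complex.I / cutSqrt (2 - e - Complex.cos t - ε * Complex.I)) =
        (fun k : ℂ => blochFactor m n c ε k ^ j * blochAmplitude c ε k) t := by
      intro t
      simp only [blochFactor, blochAmplitude, shellCos, mul_pow, ← Complex.exp_nat_mul, ← pow_mul,
        mul_comm m j, hce]
      push_cast
      congr 3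
      ring
    rw [intervalIntegral.integral_congr (fun t _ => hintg t)]
    rw [integral_eq_polygonal (F := fun k : ℂ => blochFactor m n c ε k ^ j * blochAmplitude c ε k)
      hδ hρ hlo hhi]
    · refine continuous_iff_continuousAt.2 fun t => ?_
      refine ContinuousAt.comp (g := fun k : ℂ => blochFactor m n c ε k ^ j * blochAmplitude c ε k)
        (f := fun t : ℝ => (t : ℂ)) (DifferentiableAt.continuousAt
        (differentiableAt_blochFactor_pow_mul m n j ?_)) (by fun_prop)
      refine ⟨?_, Or.inr (Or.inl ?_)⟩
      · rw [shellCos_re]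
        simp
        linarith [Real.cos_le_one t]
      · rw [shellCos_im]
        simpa
    · intro k h1 h2 h3 h4
      exact differentiableAt_blochFactor_pow_mul m n j
        (shellCos_mem_branchDomain_left hα hβ hαβ hc hcβ hε.le h1 (by linarith) h3
          (hcoshle _ (abs_le.2 ⟨by linarith, h4⟩)) (Or.inl hε))
    · intro k h1 h2 h3 h4
      exact differentiableAt_blochFactor_pow_mul m n j
        (shellCos_mem_branchDomain_right hα hβ hαβ hc hε.le (by linarith) h2 h4
          (hcoshle _ (abs_le.2 ⟨h3, by linarith⟩)) (Or.inl hε))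
    · intro k hk
      exact differentiableAt_blochFactor_pow_mul m n j (hballdom ε k hk)
  have hz : (0 : ℝ) ∈ Set.Icc (0 : ℝ) 1 := ⟨le_rfl, zero_le_one⟩
  have l1 := tendsto_sqrt_mul_integral_blochFactor_zero m n g1 (hD1 0 hz)
    (by rwa [Set.uIcc_of_le hδ.le])
  have l2 := tendsto_sqrt_mul_integral_blochFactor_zero m n g2 (hD2 0 hz)
    (by rwa [Set.uIcc_of_le hlo])
  have l4 := tendsto_sqrt_mul_integral_blochFactor_zero m n g4 (hD4 0 hz)
    (by rwa [Set.uIcc_of_le hhi])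
  have l5 := tendsto_sqrt_mul_integral_blochFactor_zero m n g5 (hD5 0 hz)
    (by rwa [Set.uIcc_of_le (by linarith)])
  have hz : ∀ {f : ℕ → ℂ}, Tendsto f atTop (𝓝 0) → Tendsto (fun j => w ^ j * f j) atTop (𝓝 0) := by
    intro f hf
    rw [tendsto_zero_iff_norm_tendsto_zero] at hf ⊢
    simpa [hw] using hf
  have hlim := (((((((hz l1).const_mul Complex.I).add (hz l2)).add
    (hdiag.const_mul (1 - Complex.I))).add
    (hz l4)).add ((hz l5).const_mul Complex.I)).const_mul (((2 * Real.pi)⁻¹ : ℝ) : ℂ))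
  simp only [mul_zero, zero_add, add_zero] at hlim
  refine hlim.congr fun j => ?_
  rw [hGeq]
  ring

/-- A point `(β, α)` of the energy shell at which the lattice vector `(n, m)`, with `n ≤ m`, is
normal to the shell. -/
structure IsShellSaddle (m n : ℕ) (α β : ℝ) : Prop where
  alpha_pos : 0 < α
  beta_nonneg : 0 ≤ β
  add_lt_pi : α + β < Real.pi
  cos_add_cos_pos : 0 < Real.cos α + Real.cos β
  pos : 0 < m
  le : n ≤ m
  normal : m * Real.sin β = n * Real.sin α

namespace IsShellSaddle

variable {m n : ℕ} {α β : ℝ}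

theorem sin_alpha_pos (h : IsShellSaddle m n α β) : 0 < Real.sin α :=
  Real.sin_pos_of_pos_of_lt_pi h.alpha_pos (by linarith [h.beta_nonneg, h.add_lt_pi])

theorem sin_beta_nonneg (h : IsShellSaddle m n α β) : 0 ≤ Real.sin β :=
  Real.sin_nonneg_of_nonneg_of_le_pi h.beta_nonneg (by linarith [h.alpha_pos, h.add_lt_pi])

theorem sin_beta_le (h : IsShellSaddle m n α β) : Real.sin β ≤ Real.sin α := by
  have h1 : (0 : ℝ) < m := by exact_mod_cast h.pos
  have h2 : (n : ℝ) ≤ m := by exact_mod_cast h.le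
  have h3 := h.normal
  have h4 := h.sin_alpha_pos
  by_contra! h5
  nlinarith

theorem beta_le (h : IsShellSaddle m n α β) : β ≤ α := by
  have h1 := h.sin_beta_le
  have h2 := h.alpha_pos
  have h3 := h.add_lt_pi
  by_contra! h4
  rcases le_or_gt β (Real.pi / 2) with h5 | h5
  · exact absurd h1 (not_le.2 (Real.sin_lt_sin_of_lt_of_le_pi_div_two (by linarith) h5 h4))
  · rw [← Real.sin_pi_sub β] at h1
    exact absurd h1 (not_le.2
      (Real.sin_lt_sin_of_lt_of_le_pi_div_two (by linarith) (by linarith) (by linarith)))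

theorem cos_alpha_le (h : IsShellSaddle m n α β) : Real.cos α ≤ Real.cos β :=
  Real.cos_le_cos_of_nonneg_of_le_pi h.beta_nonneg (by linarith [h.beta_nonneg, h.add_lt_pi])
    h.beta_le

theorem cos_beta_pos (h : IsShellSaddle m n α β) : 0 < Real.cos β := by
  linarith [h.cos_alpha_le, h.cos_add_cos_pos]

theorem cos_alpha_lt_one (h : IsShellSaddle m n α β) : Real.cos α < 1 := by
  nlinarith [Real.sin_sq_add_cos_sq α, h.sin_alpha_pos]

theorem curvature_aux_pos (h : IsShellSaddle m n α β) :
    0 < Real.cos β * Real.sin α ^ 2 + Real.cos α * Real.sin β ^ 2 := by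
  have h1 := h.sin_alpha_pos
  have h2 := h.sin_beta_le
  have h3 := h.sin_beta_nonneg
  have h4 := h.cos_beta_pos
  have h5 := h.cos_add_cos_pos
  have h6 : Real.sin β ^ 2 ≤ Real.sin α ^ 2 := by nlinarith
  have h7 : 0 < Real.sin α ^ 2 := by positivity
  rcases le_or_gt 0 (Real.cos α) with h8 | h8
  · have : 0 ≤ Real.cos α * Real.sin β ^ 2 := by positivity
    have : 0 < Real.cos β * Real.sin α ^ 2 := by positivity
    linarith
  · nlinarith

theorem curvature_mul_sin (h : IsShellSaddle m n α β) :
    (m * Real.cos β * Real.sin α + n * Real.cos α * Real.sin β) * Real.sin α =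
      m * (Real.cos β * Real.sin α ^ 2 + Real.cos α * Real.sin β ^ 2) := by
  linear_combination -(Real.cos α * Real.sin β) * h.normal

theorem curvature_pos (h : IsShellSaddle m n α β) :
    0 < m * Real.cos β * Real.sin α + n * Real.cos α * Real.sin β := by
  have h1 : (0 : ℝ) < m := by exact_mod_cast h.pos
  have h2 := mul_pos h1 h.curvature_aux_pos
  rw [← h.curvature_mul_sin] at h2
  exact pos_of_mul_pos_left h2 h.sin_alpha_pos.le

end IsShellSaddle

theorem shellCos_self (α β : ℝ) : shellCos (Real.cos α + Real.cos β) 0 β = Real.cos α := by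
  simp [shellCos]

theorem cutSqrt_cos {α : ℝ} (h0 : 0 < α) (h1 : α < Real.pi) :
    cutSqrt (Real.cos α : ℝ) = (Real.sin α : ℝ) := by
  have hs := Real.sin_pos_of_pos_of_lt_pi h0 h1
  have hc1 : Real.cos α < 1 := by nlinarith [Real.sin_sq_add_cos_sq α]
  have hc2 : -1 < Real.cos α := by nlinarith [Real.sin_sq_add_cos_sq α]
  have hre : 0 < (cutSqrt (Real.cos α : ℝ)).re :=
    cutSqrt_re_pos (by rwa [Complex.ofReal_re]) (Or.inl (by rwa [Complex.ofReal_re]))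
  have h2 : (cutSqrt (Real.cos α : ℝ) - (Real.sin α : ℝ)) *
      (cutSqrt (Real.cos α : ℝ) + (Real.sin α : ℝ)) = 0 := by
    have h3 : ((Real.sin α : ℝ) : ℂ) ^ 2 + ((Real.cos α : ℝ) : ℂ) ^ 2 = 1 := by
      exact_mod_cast Real.sin_sq_add_cos_sq α
    linear_combination cutSqrt_sq (Real.cos α : ℝ) - h3
  rcases mul_eq_zero.1 h2 with h | h
  · exact sub_eq_zero.1 h
  · have h4 := congrArg Complex.re h
    rw [Complex.add_re, Complex.ofReal_re, Complex.zero_re] at h4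
    linarith

theorem joukowski_cos {α : ℝ} (h0 : 0 < α) (h1 : α < Real.pi) :
    joukowski (Real.cos α : ℝ) = Complex.exp (Complex.I * α) := by
  rw [joukowski, cutSqrt_cos h0 h1, mul_comm Complex.I (α : ℂ), Complex.exp_mul_I]
  push_cast
  ring

theorem hasDerivAt_blochFactor (m n : ℕ) {c ε : ℝ} {k : ℂ} (hk : shellCos c ε k ∈ branchDomain) :
    HasDerivAt (blochFactor m n c ε)
      (blochFactor m n c ε k * (Complex.I * (n - m * Complex.sin k / cutSqrt (shellCos c ε k))))
      k := by
  have h1 : HasDerivAt (fun k => joukowski (shellCos c ε k)) _ k :=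
    (hasDerivAt_joukowski hk).comp k (hasDerivAt_shellCos c ε k)
  have h2 : HasDerivAt (fun k : ℂ => Complex.exp (Complex.I * (n * k))) _ k :=
    (((hasDerivAt_id k).const_mul (n : ℂ)).const_mul Complex.I).cexp
  refine (h2.mul (h1.pow m)).congr_deriv ?_
  have h3 : (m : ℂ) * joukowski (shellCos c ε k) ^ (m - 1) * joukowski (shellCos c ε k) =
      m * joukowski (shellCos c ε k) ^ m := by
    rcases m with _ | m
    · simp
    · simp [pow_succ, mul_assoc]
  simp only [blochFactor, id, mul_one, Pi.pow_apply]
  linear_combination (-Complex.I * Complex.sin k / cutSqrt (shellCos c ε k) *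
    Complex.exp (Complex.I * (n * k))) * h3

theorem hasDerivAt_cutSqrt_shellCos {c ε : ℝ} {k : ℂ} (hk : shellCos c ε k ∈ branchDomain) :
    HasDerivAt (fun k => cutSqrt (shellCos c ε k))
      (-shellCos c ε k / cutSqrt (shellCos c ε k) * Complex.sin k) k :=
  (hasDerivAt_cutSqrt hk).comp k (hasDerivAt_shellCos c ε k)

open Filter Topology Asymptotics in
theorem isLittleO_sq_of_hasDerivAt {g g' : ℝ → ℂ} (hg : ∀ᶠ u in 𝓝 0, HasDerivAt g (g' u) u)
    (h0 : g 0 = 0) (hg' : g' =o[𝓝 0] (fun u : ℝ => u)) : g =o[𝓝 0] (fun u : ℝ => u ^ 2) := by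
  refine isLittleO_iff.2 fun C hC => ?_
  obtain ⟨r, hr, hball⟩ := Metric.eventually_nhds_iff_ball.1 (hg.and (isLittleO_iff.1 hg' hC))
  filter_upwards [Metric.ball_mem_nhds (0 : ℝ) hr] with u hu
  have hu' : |u| < r := by simpa using hu
  have hsub : Metric.closedBall (0 : ℝ) |u| ⊆ Metric.ball 0 r :=
    Metric.closedBall_subset_ball hu'
  have := (convex_closedBall (0 : ℝ) |u|).norm_image_sub_le_of_norm_hasDerivWithin_le
    (f := g) (f' := g') (C := C * |u|) (x := 0) (y := u)
    (fun x hx => (hball x (hsub hx)).1.hasDerivWithinAt)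
    (fun x hx => by
      refine (hball x (hsub hx)).2.trans ?_
      have : |x| ≤ |u| := by simpa using hx
      rw [Real.norm_eq_abs]
      gcongr) (by simp) (by simp)
  rw [h0, sub_zero, sub_zero, Real.norm_eq_abs] at this
  rw [norm_pow, Real.norm_eq_abs]
  linarith [this]

open Filter Topology Asymptotics in
theorem norm_le_one_sub_of_isLittleO {h : ℝ → ℂ} {κ : ℝ} (hκ : 0 < κ)
    (hlim : (fun u : ℝ => h u - (1 - κ * u ^ 2)) =o[𝓝 0] (fun u : ℝ => u ^ 2)) :
    ∀ᶠ u in 𝓝 0, ‖h u‖ ≤ 1 - κ / 2 * u ^ 2 := by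
  have h1 : Tendsto (fun u : ℝ => κ * u ^ 2) (𝓝 0) (𝓝 0) := by
    have : Continuous fun u : ℝ => κ * u ^ 2 := by fun_prop
    simpa using this.tendsto 0
  filter_upwards [isLittleO_iff.1 hlim (half_pos hκ), h1.eventually_le_const zero_lt_one]
    with u hu hu1
  have h2 : ‖(1 - κ * u ^ 2 : ℂ)‖ = 1 - κ * u ^ 2 := by
    have : (1 - κ * u ^ 2 : ℂ) = ((1 - κ * u ^ 2 : ℝ) : ℂ) := by push_cast; ring
    rw [this, Complex.norm_real, Real.norm_eq_abs, abs_of_nonneg (by linarith)]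
  have h3 : ‖h u‖ ≤ ‖h u - (1 - κ * u ^ 2)‖ + ‖(1 - κ * u ^ 2 : ℂ)‖ :=
    norm_le_norm_sub_add _ _
  rw [norm_pow, Real.norm_eq_abs, sq_abs] at hu
  linarith

namespace IsShellSaddle

variable {m n : ℕ} {α β : ℝ}

open Filter Topology in
theorem eventually_shellCos_re (h : IsShellSaddle m n α β) : ∀ᶠ k in 𝓝 (β : ℂ),
    -1 < (shellCos (Real.cos α + Real.cos β) 0 k).re ∧
      (shellCos (Real.cos α + Real.cos β) 0 k).re < 1 := by
  have h1 : ContinuousAt (fun k => (shellCos (Real.cos α + Real.cos β) 0 k).re) β :=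
    Complex.continuous_re.continuousAt.comp (hasDerivAt_shellCos _ _ _).continuousAt
  have h2 : (shellCos (Real.cos α + Real.cos β) 0 β).re ∈ Set.Ioo (-1 : ℝ) 1 := by
    rw [shellCos_self, Complex.ofReal_re]
    exact ⟨by linarith [h.cos_add_cos_pos, Real.cos_le_one β], h.cos_alpha_lt_one⟩
  exact h1.eventually_mem (Ioo_mem_nhds h2.1 h2.2)

theorem shellCos_mem_branchDomain (h : IsShellSaddle m n α β) :
    shellCos (Real.cos α + Real.cos β) 0 β ∈ branchDomain :=
  ⟨h.eventually_shellCos_re.self_of_nhds.1, Or.inl h.eventually_shellCos_re.self_of_nhds.2⟩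

theorem alpha_lt_pi (h : IsShellSaddle m n α β) : α < Real.pi := by
  linarith [h.beta_nonneg, h.add_lt_pi]

theorem cutSqrt_shellCos (h : IsShellSaddle m n α β) :
    cutSqrt (shellCos (Real.cos α + Real.cos β) 0 β) = (Real.sin α : ℝ) := by
  rw [shellCos_self, cutSqrt_cos h.alpha_pos h.alpha_lt_pi]

theorem blochFactor_self (h : IsShellSaddle m n α β) :
    blochFactor m n (Real.cos α + Real.cos β) 0 β = Complex.exp (Complex.I * (m * α + n * β)) := by
  rw [blochFactor, shellCos_self, joukowski_cos h.alpha_pos h.alpha_lt_pi, ← Complex.exp_nat_mul,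
    ← Complex.exp_add]
  congr 1
  ring

open Filter Topology Asymptotics in
/-- The stationary phase expansion of the normalized wave along the steepest descent line. -/
theorem blochFactor_isLittleO (h : IsShellSaddle m n α β) :
    (fun u : ℝ => Complex.exp (-Complex.I * (m * α + n * β)) *
        blochFactor m n (Real.cos α + Real.cos β) 0 (β + (1 - Complex.I) * u) -
      (1 - ((m * Real.cos β * Real.sin α + n * Real.cos α * Real.sin β) / Real.sin α ^ 2 : ℝ) *
        (u : ℂ) ^ 2)) =o[𝓝 0] (fun u : ℝ => u ^ 2) := by
  set c := Real.cos α + Real.cos β with hc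
  set w := Complex.exp (-Complex.I * (m * α + n * β)) with hw
  set κ := (m * Real.cos β * Real.sin α + n * Real.cos α * Real.sin β) / Real.sin α ^ 2 with hκ
  have hwP : w * blochFactor m n c 0 β = 1 := by
    rw [h.blochFactor_self, hw, ← Complex.exp_add, neg_mul, neg_add_cancel, Complex.exp_zero]
  have hs := h.sin_alpha_pos
  have hs' : ((Real.sin α : ℝ) : ℂ) ≠ 0 := by exact_mod_cast hs.ne'
  have hγ : ∀ u : ℝ, HasDerivAt (fun u : ℝ => (β : ℂ) + (1 - Complex.I) * u) (1 - Complex.I) u := by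
    intro u
    have := (((hasDerivAt_id (u : ℂ)).const_mul (1 - Complex.I)).const_add (β : ℂ)).comp_ofReal
    simpa using this
  have hγ0 : Tendsto (fun u : ℝ => (β : ℂ) + (1 - Complex.I) * u) (𝓝 0) (𝓝 β) := by
    simpa using (hγ 0).continuousAt.tendsto
  refine isLittleO_sq_of_hasDerivAt (g' := fun u : ℝ => w * (blochFactor m n c 0
    (β + (1 - Complex.I) * u) * (Complex.I * (n - m * Complex.sin (β + (1 - Complex.I) * u) /
      cutSqrt (shellCos c 0 (β + (1 - Complex.I) * u)))) * (1 - Complex.I)) + 2 * κ * u) ?_ ?_ ?_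
  · filter_upwards [hγ0.eventually h.eventually_shellCos_re] with u hu
    have h1 := ((hasDerivAt_blochFactor m n (ε := 0) ⟨hu.1, Or.inl hu.2⟩).comp u (hγ u)).const_mul w
    have h2 := ((((hasDerivAt_id (u : ℂ)).pow 2).const_mul (κ : ℂ)).const_sub 1).comp_ofReal
    refine (h1.sub h2).congr_deriv ?_
    simp
    ring
  · simp [hwP]
  · have hdom := h.shellCos_mem_branchDomain
    have hcs := h.cutSqrt_shellCos
    have h1 := hasDerivAt_blochFactor m n hdom
    have h2 := ((((Complex.hasDerivAt_sin (β : ℂ)).const_mul (m : ℂ)).div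
      (hasDerivAt_cutSqrt_shellCos hdom) (cutSqrt_ne_zero hdom)).const_sub (n : ℂ)).const_mul
      Complex.I
    have h3 := h1.mul h2
    have hnormal : (m : ℂ) * Complex.sin β = n * Complex.sin α := by exact_mod_cast h.normal
    have hQ0 : (n : ℂ) - m * Complex.sin β / cutSqrt (shellCos c 0 β) = 0 := by
      rw [hcs, hnormal]
      push_cast at hs' ⊢
      field_simp
      ring
    have h4 : HasDerivAt (fun k : ℂ => blochFactor m n c 0 k *
        (Complex.I * (n - m * Complex.sin k / cutSqrt (shellCos c 0 k))))
        (blochFactor m n c 0 β * (-Complex.I * κ)) β := by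
      refine h3.congr_deriv ?_
      rw [hQ0, hcs, shellCos_self, hκ]
      push_cast at hs' ⊢
      field_simp
      linear_combination (-blochFactor m n (Real.cos α + Real.cos β) 0 β * Complex.sin β *
        Complex.cos α) * hnormal
    have h5 : HasDerivAt (fun u : ℝ => w * (blochFactor m n c 0
        (β + (1 - Complex.I) * u) * (Complex.I * (n - m * Complex.sin (β + (1 - Complex.I) * u) /
        cutSqrt (shellCos c 0 (β + (1 - Complex.I) * u)))) * (1 - Complex.I)) + 2 * κ * u) 0 0 := by
      have e0 : (β : ℂ) + (1 - Complex.I) * (0 : ℝ) = β := by simp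
      rw [← e0] at h4
      have h6 := ((h4.comp (0 : ℝ) (hγ 0)).mul_const (1 - Complex.I)).const_mul w
      have h7 := ((hasDerivAt_id ((0 : ℝ) : ℂ)).const_mul (2 * κ : ℂ)).comp_ofReal
      refine (h6.add h7).congr_deriv ?_
      rw [e0]
      linear_combination (-Complex.I * κ * (1 - Complex.I) ^ 2) * hwP +
        (2 * κ + -Complex.I * κ) * Complex.I_sq
    have h8 := hasDerivAt_iff_isLittleO.1 h5
    simpa [hQ0] using h8

open Filter Topology in
theorem eventually_tendsto_diagonal (h : IsShellSaddle m n α β) :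
    ∀ᶠ δ : ℝ in 𝓝[>] 0, Tendsto (fun j : ℕ =>
      Complex.exp (-Complex.I * (m * α + n * β)) ^ j * ((√(j : ℝ) : ℂ) * ∫ u in (-δ)..δ,
        blochFactor m n (Real.cos α + Real.cos β) 0 (β + (1 - Complex.I) * u) ^ j *
          blochAmplitude (Real.cos α + Real.cos β) 0 (β + (1 - Complex.I) * u))) atTop
      (𝓝 (Complex.I / (Real.sin α : ℝ) * (√(Real.pi /
        ((m * Real.cos β * Real.sin α + n * Real.cos α * Real.sin β) / Real.sin α ^ 2)) : ℝ))) := by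
  have hlim := h.blochFactor_isLittleO
  have hκ : 0 < (m * Real.cos β * Real.sin α + n * Real.cos α * Real.sin β) / Real.sin α ^ 2 :=
    div_pos h.curvature_pos (pow_pos h.sin_alpha_pos 2)
  have hγ : Continuous fun u : ℝ => (β : ℂ) + (1 - Complex.I) * u := by fun_prop
  have hγ0 : Tendsto (fun u : ℝ => (β : ℂ) + (1 - Complex.I) * u) (𝓝 0) (𝓝 β) := by
    simpa using hγ.tendsto 0
  have hev := (norm_le_one_sub_of_isLittleO hκ hlim).and (hγ0.eventually h.eventually_shellCos_re)
  obtain ⟨r, hr, hball⟩ := Metric.eventually_nhds_iff_ball.1 hev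
  filter_upwards [Ioo_mem_nhdsGT hr] with δ hδ
  have hin : ∀ u ∈ Set.Icc (-δ) δ, u ∈ Metric.ball (0 : ℝ) r := by
    intro u hu
    rw [mem_ball_zero_iff, Real.norm_eq_abs]
    exact (abs_le.2 hu).trans_lt hδ.2
  have hdom : ∀ u ∈ Set.Icc (-δ) δ,
      shellCos (Real.cos α + Real.cos β) 0 (β + (1 - Complex.I) * u) ∈ branchDomain :=
    fun u hu => ⟨(hball u (hin u hu)).2.1, Or.inl (hball u (hin u hu)).2.2⟩
  have h0 : Continuous fun u : ℝ => ((0 : ℝ), (β : ℂ) + (1 - Complex.I) * u) := by fun_prop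
  have hL := tendsto_sqrt_mul_integral_pow hκ hδ.1
    (h := fun u : ℝ => Complex.exp (-Complex.I * (m * α + n * β)) *
        blochFactor m n (Real.cos α + Real.cos β) 0 (β + (1 - Complex.I) * u))
    (B := fun u : ℝ => blochAmplitude (Real.cos α + Real.cos β) 0 (β + (1 - Complex.I) * u))
    (fun u hu => ?_) (fun u hu => ?_) (fun u hu => (hball u (hin u hu)).1) hlim
  · simp only [Complex.ofReal_zero, mul_zero, add_zero] at hL
    rw [blochAmplitude, h.cutSqrt_shellCos] at hL
    refine hL.congr fun j => ?_
    rw [mul_left_comm]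
    congr 1
    rw [← intervalIntegral.integral_const_mul]
    refine intervalIntegral.integral_congr fun u _ => ?_
    ring
  · exact (ContinuousAt.comp (f := fun u : ℝ => ((0 : ℝ), (β : ℂ) + (1 - Complex.I) * u))
      (continuousAt_blochFactor m n (p := (0, β + (1 - Complex.I) * u)) (hdom u hu))
      h0.continuousAt).continuousWithinAt.const_mul _
  · exact (ContinuousAt.comp (f := fun u : ℝ => ((0 : ℝ), (β : ℂ) + (1 - Complex.I) * u))
      (continuousAt_blochAmplitude (p := (0, β + (1 - Complex.I) * u)) (hdom u hu))
      h0.continuousAt).continuousWithinAt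

end IsShellSaddle

theorem sinh_le_self_mul_cosh {x : ℝ} (hx : 0 ≤ x) : Real.sinh x ≤ x * Real.cosh x := by
  have := (convex_Icc 0 x).image_sub_le_mul_sub_of_deriv_le (f := Real.sinh) (C := Real.cosh x)
    Real.continuous_sinh.continuousOn Real.differentiable_sinh.differentiableOn
    (fun y hy => by
      rw [interior_Icc] at hy
      rw [Real.deriv_sinh, Real.cosh_le_cosh, abs_of_pos hy.1, abs_of_nonneg hx]
      exact hy.2.le) 0 ⟨le_rfl, hx⟩ x ⟨hx, le_rfl⟩ hx
  rw [Real.sinh_zero] at this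
  linarith

theorem norm_exp_I_mul (n : ℕ) (k : ℂ) :
    ‖Complex.exp (Complex.I * (n * k))‖ = Real.exp (-(n * k.im)) := by
  rw [Complex.norm_exp]
  simp

theorem norm_blochFactor_lt_one_of_norm_joukowski {m n : ℕ} (hm : 0 < m) {c ε : ℝ} {k : ℂ}
    (hk : 0 ≤ k.im) (h : ‖joukowski (shellCos c ε k)‖ < 1) : ‖blochFactor m n c ε k‖ < 1 := by
  rw [blochFactor, norm_mul, norm_pow, norm_exp_I_mul]
  have h1 : Real.exp (-(n * k.im)) ≤ 1 := Real.exp_le_one_iff.2 (by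
    have : 0 ≤ n * k.im := by positivity
    linarith)
  have h2 := pow_lt_one₀ (norm_nonneg _) h hm.ne'
  calc _ ≤ 1 * ‖joukowski (shellCos c ε k)‖ ^ m := by gcongr
    _ < 1 := by linarith

/-- The modulus of the wave in terms of the second quasi-momentum `x + i y`. -/
theorem exists_norm_blochFactor_lt_one_iff (m n : ℕ) (c : ℝ) (k : ℂ) :
    ∃ x y : ℝ, Real.sin x * Real.sinh y = -(Real.sin k.re * Real.sinh k.im) ∧
      Real.sin x * Real.cosh y = (cutSqrt (shellCos c 0 k)).re ∧
      (‖blochFactor m n c 0 k‖ < 1 ↔ 0 < n * k.im + m * y) := by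
  obtain ⟨q, h1, h2, h3⟩ := exists_joukowski_eq_exp (shellCos c 0 k)
  refine ⟨q.re, q.im, ?_, ?_, ?_⟩
  · have h4 := congrArg Complex.im h2
    rw [shellCos_im, Complex.cos_eq] at h4
    simp [← Complex.ofReal_cos, ← Complex.ofReal_sin, ← Complex.ofReal_cosh,
      ← Complex.ofReal_sinh] at h4
    linarith
  · rw [← h3, Complex.sin_eq]
    simp [← Complex.ofReal_cos, ← Complex.ofReal_sin, ← Complex.ofReal_cosh,
      ← Complex.ofReal_sinh]
  · have h5 : ‖blochFactor m n c 0 k‖ = Real.exp (-(n * k.im + m * q.im)) := by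
      rw [blochFactor, norm_mul, norm_pow, norm_exp_I_mul, h1]
      have := norm_exp_I_mul 1 q
      rw [Nat.cast_one, one_mul, Nat.cast_one, one_mul] at this
      rw [this, ← Real.exp_nat_mul, ← Real.exp_add]
      congr 1
      ring
    rw [h5, Real.exp_lt_one_iff, neg_lt_zero]

theorem norm_blochFactor_lt_one_of_im_pos {m n : ℕ} {c : ℝ} {k : ℂ} (hk : 0 < k.im)
    (hsin : 0 ≤ Real.sin k.re) (hR : 0 < (cutSqrt (shellCos c 0 k)).re)
    (hE : 0 < (n * (cutSqrt (shellCos c 0 k)).re) ^ 2 - (m * (Complex.sin k).re) ^ 2 -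
      n ^ 2 * (shellCos c 0 k).im ^ 2) : ‖blochFactor m n c 0 k‖ < 1 := by
  obtain ⟨x, y, h1, h2, h3⟩ := exists_norm_blochFactor_lt_one_iff m n c k
  rw [h3]
  have hsk : (Complex.sin k).re = Real.sin k.re * Real.cosh k.im := by
    rw [Complex.sin_eq]
    simp [← Complex.ofReal_cos, ← Complex.ofReal_sin, ← Complex.ofReal_cosh,
      ← Complex.ofReal_sinh]
  rw [shellCos_im, ← h2, hsk, sub_zero] at hE
  rw [← h2] at hR
  have hx : 0 < Real.sin x := pos_of_mul_pos_left hR (Real.cosh_pos y).le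
  have hch := Real.cosh_sq y
  have hchk := Real.cosh_pos k.im
  have hshk := Real.sinh_pos_iff.2 hk
  have hm0 : (0 : ℝ) ≤ m := Nat.cast_nonneg m
  have hn0 : (0 : ℝ) ≤ n := Nat.cast_nonneg n
  have hE' : (m * (Real.sin k.re * Real.cosh k.im)) ^ 2 < (n * Real.sin x) ^ 2 := by
    have h4 : (Real.sin x * Real.sinh y) ^ 2 = (Real.sin k.re * Real.sinh k.im) ^ 2 := by
      rw [h1, neg_sq]
    nlinarith
  have hlt := lt_of_pow_lt_pow_left₀ 2 (by positivity) hE'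
  have hy : y ≤ 0 := by
    rw [← Real.sinh_nonpos_iff]
    have : 0 ≤ Real.sin k.re * Real.sinh k.im := by positivity
    by_contra! h
    nlinarith
  have hy1 : y ≤ 0 ∧ Real.sinh y ≤ y := ⟨hy, Real.sinh_le_self_iff.2 hy⟩
  have hsk1 := sinh_le_self_mul_cosh hk.le
  have h6 : (-(m * Real.sinh y) * Real.cosh k.im) * Real.sin x <
      (n * Real.sinh k.im) * Real.sin x := by
    have := mul_lt_mul_of_pos_right hlt hshk
    linear_combination this - m * Real.cosh k.im * h1
  have h7 := lt_of_mul_lt_mul_right h6 hx.le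
  have h8 : -(m * Real.sinh y) * Real.cosh k.im < (n * k.im) * Real.cosh k.im := by
    have := mul_le_mul_of_nonneg_left hsk1 hn0
    linarith
  have h9 := lt_of_mul_lt_mul_right h8 hchk.le
  have := mul_le_mul_of_nonneg_left hy1.2 hm0
  linarith

theorem norm_blochFactor_lt_one_of_im_neg {m n : ℕ} {c : ℝ} {k : ℂ} (hk : k.im < 0)
    (hsin : 0 < Real.sin k.re) (hR : 0 < (cutSqrt (shellCos c 0 k)).re)
    (hD : n * (cutSqrt (shellCos c 0 k)).re - m * Real.sin k.re < 0) :
    ‖blochFactor m n c 0 k‖ < 1 := by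
  obtain ⟨x, y, h1, h2, h3⟩ := exists_norm_blochFactor_lt_one_iff m n c k
  rw [h3]
  rw [← h2] at hR hD
  have hx : 0 < Real.sin x := pos_of_mul_pos_left hR (Real.cosh_pos y).le
  have hshk := Real.sinh_neg_iff.2 hk
  have hchy := Real.cosh_pos y
  have hm0 : (0 : ℝ) ≤ m := Nat.cast_nonneg m
  have hn0 : (0 : ℝ) ≤ n := Nat.cast_nonneg n
  have hy : 0 < y := by
    rw [← Real.sinh_pos_iff]
    by_contra! h
    nlinarith
  have h4 := sinh_le_self_mul_cosh hy.le
  have h5 : (-(n * Real.sinh k.im) * Real.cosh y) * Real.sin x <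
      (m * Real.sinh y) * Real.sin x := by
    have := mul_pos_of_neg_of_neg hD hshk
    linear_combination this - m * h1
  have h6 := lt_of_mul_lt_mul_right h5 hx.le
  have h7 : -(n * Real.sinh k.im) * Real.cosh y < (m * y) * Real.cosh y := by
    have := mul_le_mul_of_nonneg_left h4 hm0
    linarith
  have h8 := lt_of_mul_lt_mul_right h7 hchy.le
  have h9 := mul_le_mul_of_nonneg_left (Real.sinh_le_self_iff.2 hk.le) hn0
  linarith

open Filter Topology Asymptotics in
theorem eventually_sign_of_hasFDerivAt {f : ℂ → ℝ} {L : ℂ →L[ℝ] ℝ} {b : ℝ} {C : ℝ} (hC : 0 < C)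
    (hf : HasFDerivAt f L b) (h0 : f b = 0) (hL : ∀ v, L v = -(C * v.re)) :
    ∀ᶠ k in 𝓝 (b : ℂ), k.im ≠ 0 →
      (|k.im| ≤ b - k.re → 0 < f k) ∧ (|k.im| ≤ k.re - b → f k < 0) := by
  have h1 := isLittleO_iff.1 hf.isLittleO (show (0 : ℝ) < C / 4 by positivity)
  filter_upwards [h1] with k hk him
  have hpos := abs_pos.2 him
  rw [h0, hL, sub_zero, Complex.sub_re, Complex.ofReal_re, Real.norm_eq_abs] at hk
  have h2 := Complex.norm_le_abs_re_add_abs_im (k - b)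
  rw [Complex.sub_re, Complex.sub_im, Complex.ofReal_re, Complex.ofReal_im, sub_zero] at h2
  have h3 : |f k - -(C * (k.re - b))| ≤ C / 4 * (|k.re - b| + |k.im|) :=
    hk.trans (by gcongr)
  rw [abs_le] at h3
  constructor
  · intro h4
    rw [abs_of_nonpos (by linarith : k.re - b ≤ 0)] at h3
    nlinarith
  · intro h4
    rw [abs_of_nonneg (by linarith : 0 ≤ k.re - b)] at h3
    nlinarith

theorem cutSqrt_ofReal {a : ℝ} (h1 : -1 < a) (h2 : a < 1) :
    (cutSqrt a).re ^ 2 = 1 - a ^ 2 := by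
  obtain ⟨e1, e2⟩ := cutSqrt_re_im a
  have hR : 0 < (cutSqrt a).re := cutSqrt_re_pos (by simpa) (Or.inl (by simpa))
  rw [Complex.ofReal_re, Complex.ofReal_im] at e1 e2
  have him : (cutSqrt a).im = 0 := by
    rw [mul_zero, neg_zero] at e2
    exact (mul_eq_zero.1 e2).resolve_left hR.ne'
  rw [him] at e1
  linarith

theorem cutSqrt_ofReal_re_of_one_le {a : ℝ} (h : 1 ≤ a) : (cutSqrt a).re = 0 := by
  obtain ⟨e1, e2⟩ := cutSqrt_re_im a
  rw [Complex.ofReal_re, Complex.ofReal_im] at e1 e2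
  by_contra hR
  rw [mul_zero, neg_zero] at e2
  have him := (mul_eq_zero.1 e2).resolve_left hR
  rw [him] at e1
  have : 0 < (cutSqrt a).re ^ 2 := by positivity
  nlinarith

theorem shellCos_ofReal (c t : ℝ) : shellCos c 0 t = ((c - Real.cos t : ℝ) : ℂ) := by
  simp [shellCos]

namespace IsShellSaddle

variable {m n : ℕ} {α β : ℝ}

theorem normal_sq (h : IsShellSaddle m n α β) :
    (m : ℝ) ^ 2 * (1 - Real.cos β ^ 2) = n ^ 2 * (1 - Real.cos α ^ 2) := by
  rw [← Real.sin_sq, ← Real.sin_sq, ← mul_pow, ← mul_pow, h.normal]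

theorem sq_lt_of_cos_lt (h : IsShellSaddle m n α β) (hn : 0 < n) {x : ℝ} (hx : Real.cos β < x) :
    (m : ℝ) ^ 2 * (1 - x ^ 2) < n ^ 2 * (1 - (Real.cos α + Real.cos β - x) ^ 2) := by
  have h1 := h.normal_sq
  have h2 : (n : ℝ) ^ 2 ≤ m ^ 2 := by
    have : (n : ℝ) ≤ m := by exact_mod_cast h.le
    gcongr
  have h3 : (0 : ℝ) < n ^ 2 := by positivity
  have h4 := h.cos_beta_pos
  have h5 := mul_pos h3 h.cos_add_cos_pos
  have h6 : 0 < (m ^ 2 - n ^ 2) * (x + Real.cos β) + 2 * (n ^ 2 * (Real.cos α + Real.cos β)) := by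
    have : 0 ≤ (m ^ 2 - n ^ 2 : ℝ) * (x + Real.cos β) := mul_nonneg (by linarith) (by linarith)
    linarith
  have h7 := mul_pos (sub_pos.2 hx) h6
  linear_combination h7 + h1

theorem sq_lt_of_lt_cos (h : IsShellSaddle m n α β) {x : ℝ}
    (hx0 : Real.cos α + Real.cos β - 1 ≤ x) (hx : x < Real.cos β) :
    (n : ℝ) ^ 2 * (1 - (Real.cos α + Real.cos β - x) ^ 2) < m ^ 2 * (1 - x ^ 2) := by
  have h1 := h.normal_sq
  have h2 : (n : ℝ) ^ 2 ≤ m ^ 2 := by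
    have : (n : ℝ) ≤ m := by exact_mod_cast h.le
    gcongr
  have h0 : (0 : ℝ) < m ^ 2 := by
    have : (0 : ℝ) < m := by exact_mod_cast h.pos
    positivity
  have hcα := h.cos_alpha_lt_one
  have hcp := h.cos_add_cos_pos
  have hcβ := Real.cos_le_one β
  set c := Real.cos α + Real.cos β with hc
  have h5 : 0 < (m : ℝ) ^ 2 * (1 - (c - 1) ^ 2) := mul_pos h0 (by nlinarith)
  have h6 : (1 - Real.cos α) *
      ((m ^ 2 - n ^ 2) * (c - 1 + Real.cos β) + 2 * (n ^ 2 * c)) =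
      (m : ℝ) ^ 2 * (1 - (c - 1) ^ 2) := by
    rw [hc]
    linear_combination -h1
  rw [← h6] at h5
  have h7 := pos_of_mul_pos_right h5 (by linarith)
  have h8 : 0 < (m ^ 2 - n ^ 2) * (x + Real.cos β) + 2 * (n ^ 2 * c) := by
    have := mul_le_mul_of_nonneg_left hx0 (sub_nonneg.2 h2)
    linarith
  have h9 := mul_pos (sub_pos.2 hx) h8
  rw [hc] at h9 ⊢
  linear_combination h9 - h1

end IsShellSaddle

open Filter Topology in
theorem eventually_add_mul_I {p : ℂ → Prop} {t₀ : ℝ} (a : ℂ) (h : ∀ᶠ k in 𝓝 (t₀ : ℂ), p k) :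
    ∀ᶠ z : ℝ × ℝ in 𝓝 (0, t₀), p (z.2 + z.1 * a) := by
  have h1 : Continuous fun z : ℝ × ℝ => (z.2 : ℂ) + z.1 * a := by fun_prop
  have h2 : Tendsto (fun z : ℝ × ℝ => (z.2 : ℂ) + z.1 * a) (𝓝 (0, t₀)) (𝓝 t₀) := by
    simpa using h1.tendsto ((0 : ℝ), t₀)
  exact h2.eventually h

namespace IsShellSaddle

variable {m n : ℕ} {α β : ℝ}

theorem hasFDerivAt_re_cutSqrt (h : IsShellSaddle m n α β) :
    HasFDerivAt (fun k => (cutSqrt (shellCos (Real.cos α + Real.cos β) 0 k)).re)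
      ((-(Real.cos α * Real.sin β / Real.sin α)) • Complex.reCLM) (β : ℂ) := by
  have h1 := (hasDerivAt_cutSqrt_shellCos h.shellCos_mem_branchDomain).hasFDerivAt.restrictScalars ℝ
  rw [h.cutSqrt_shellCos, shellCos_self] at h1
  refine (Complex.reCLM.hasFDerivAt.comp (β : ℂ) h1).congr_fderiv ?_
  ext v
  simp [← Complex.ofReal_sin, -Complex.ofReal_cos]
  ring

open Filter Topology in
theorem eventually_norm_lt_one_vertical (h : IsShellSaddle m n α β) :
    ∀ᶠ k in 𝓝 (Real.pi : ℂ), ‖blochFactor m n (Real.cos α + Real.cos β) 0 k‖ < 1 := by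
  have hre : (shellCos (Real.cos α + Real.cos β) 0 Real.pi).re = Real.cos α + Real.cos β + 1 := by
    rw [shellCos_ofReal, Complex.ofReal_re, Real.cos_pi]
    ring
  have him : (shellCos (Real.cos α + Real.cos β) 0 Real.pi).im = 0 := by
    rw [shellCos_ofReal, Complex.ofReal_im]
  have hc := h.cos_add_cos_pos
  have hdom : shellCos (Real.cos α + Real.cos β) 0 Real.pi ∈ branchDomain :=
    ⟨by rw [hre]; linarith, Or.inr (Or.inr ⟨by rw [hre]; linarith, him.le⟩)⟩
  have h1 := (hasDerivAt_blochFactor m n hdom).continuousAt.norm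
  refine h1.eventually_lt continuousAt_const ?_
  refine norm_blochFactor_lt_one_of_norm_joukowski h.pos (by simp) ?_
  exact norm_joukowski_lt_one (by rw [hre]; linarith) (Or.inr ⟨by rw [hre]; linarith, him⟩)

open Filter Topology in
theorem eventually_norm_lt_one_right (h : IsShellSaddle m n α β) :
    ∀ᶠ δ : ℝ in 𝓝[>] 0, ∀ t ∈ Set.Icc (β + δ) Real.pi,
      ‖blochFactor m n (Real.cos α + Real.cos β) 0 (t - δ * Complex.I)‖ < 1 := by
  set c := Real.cos α + Real.cos β with hc
  have hc0 : 0 < c := h.cos_add_cos_pos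
  have key : ∀ᶠ δ : ℝ in 𝓝 0, ∀ t ∈ Set.Icc β Real.pi, 0 < δ → β + δ ≤ t →
      ‖blochFactor m n c 0 (t + δ * -Complex.I)‖ < 1 := by
    refine isCompact_Icc.eventually_forall_of_forall_eventually fun t₀ ht₀ => ?_
    rcases ht₀.2.eq_or_lt with hpi | hpi
    · subst hpi
      filter_upwards [eventually_add_mul_I (-Complex.I) h.eventually_norm_lt_one_vertical]
        with z hz _ _ using hz
    have hD : ∀ᶠ k in 𝓝 (t₀ : ℂ), k.im ≠ 0 → |k.im| ≤ k.re - β →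
        n * (cutSqrt (shellCos c 0 k)).re - m * Real.sin k.re < 0 := by
      rcases ht₀.1.eq_or_lt with hb | hb
      · subst hb
        have hsinD : HasFDerivAt (fun k : ℂ => Real.sin k.re)
            (Real.cos β • Complex.reCLM) (β : ℂ) := by
          have := (Real.hasDerivAt_sin (β : ℂ).re).comp_hasFDerivAt (β : ℂ)
            Complex.reCLM.hasFDerivAt
          rwa [Complex.ofReal_re] at this
        have h1 := (h.hasFDerivAt_re_cutSqrt.const_mul (n : ℝ)).sub (hsinD.const_mul (m : ℝ))
        have hsin := h.sin_alpha_pos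
        refine (eventually_sign_of_hasFDerivAt
          (C := (m * Real.cos β * Real.sin α + n * Real.cos α * Real.sin β) / Real.sin α)
          (div_pos h.curvature_pos hsin) h1 ?_ ?_).mono fun k hk him => (hk him).2
        · simp only [Pi.sub_apply]
          rw [h.cutSqrt_shellCos, Complex.ofReal_re, Complex.ofReal_re]
          linarith [h.normal]
        · intro v
          simp
          field_simp
          ring
      · have hsin : 0 < Real.sin t₀ :=
          Real.sin_pos_of_pos_of_lt_pi (h.beta_nonneg.trans_lt hb) hpi
        have hcos : Real.cos t₀ < Real.cos β :=
          Real.cos_lt_cos_of_nonneg_of_le_pi h.beta_nonneg hpi.le hb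
        have hm : (0 : ℝ) < m := by exact_mod_cast h.pos
        have hcont : ContinuousAt
            (fun k => n * (cutSqrt (shellCos c 0 k)).re - m * Real.sin k.re) (t₀ : ℂ) := by
          have h1 : ContinuousAt (fun k => cutSqrt (shellCos c 0 k)) (t₀ : ℂ) :=
            ContinuousAt.comp (g := cutSqrt) (continuous_cutSqrt_at
              (by rw [shellCos_ofReal, Complex.ofReal_re]; linarith [Real.cos_le_one t₀])
              (by rw [shellCos_ofReal, Complex.ofReal_im])) (hasDerivAt_shellCos _ _ _).continuousAt
          have h2 : ContinuousAt (fun k => (cutSqrt (shellCos c 0 k)).re) (t₀ : ℂ) :=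
            Complex.continuous_re.continuousAt.comp h1
          refine (h2.const_mul _).sub (Continuous.continuousAt ?_)
          fun_prop
        refine (hcont.eventually_lt continuousAt_const ?_).mono fun k hk _ _ => hk
        rw [shellCos_ofReal, Complex.ofReal_re]
        rcases lt_or_ge (c - Real.cos t₀) 1 with h3 | h3
        · have h4 := h.sq_lt_of_lt_cos (x := Real.cos t₀) (by linarith) hcos
          rw [← hc, ← cutSqrt_ofReal (by linarith [Real.cos_le_one t₀]) h3, ← Real.sin_sq,
            ← mul_pow, ← mul_pow] at h4
          have := lt_of_pow_lt_pow_left₀ 2 (by positivity) h4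
          linarith
        · rw [cutSqrt_ofReal_re_of_one_le h3]
          have := mul_pos hm hsin
          linarith
    have hre : ∀ᶠ k in 𝓝 (t₀ : ℂ), -1 < (shellCos c 0 k).re := by
      have h1 : ContinuousAt (fun k => (shellCos c 0 k).re) (t₀ : ℂ) :=
        Complex.continuous_re.continuousAt.comp (hasDerivAt_shellCos _ _ _).continuousAt
      refine continuousAt_const.eventually_lt h1 ?_
      rw [shellCos_ofReal, Complex.ofReal_re]
      linarith [Real.cos_le_one t₀]
    have hltpi : ∀ᶠ k in 𝓝 (t₀ : ℂ), k.re < Real.pi :=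
      Complex.continuous_re.continuousAt.eventually_lt continuousAt_const (by simpa using hpi)
    filter_upwards [eventually_add_mul_I (-Complex.I) (hD.and (hre.and hltpi))]
      with z ⟨hz1, hz2, hz3⟩ hz0 hzt
    have kre : ((z.2 : ℂ) + z.1 * -Complex.I).re = z.2 := by simp
    have kim : ((z.2 : ℂ) + z.1 * -Complex.I).im = -z.1 := by simp
    have hsin : 0 < Real.sin ((z.2 : ℂ) + z.1 * -Complex.I).re := by
      rw [kre] at hz3 ⊢
      exact Real.sin_pos_of_pos_of_lt_pi (by linarith [h.beta_nonneg]) hz3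
    have him : ((z.2 : ℂ) + z.1 * -Complex.I).im < 0 := by rw [kim]; linarith
    have hA : (shellCos c 0 ((z.2 : ℂ) + z.1 * -Complex.I)).im < 0 := by
      rw [shellCos_im, sub_zero]
      exact mul_neg_of_pos_of_neg hsin (Real.sinh_neg_iff.2 him)
    refine norm_blochFactor_lt_one_of_im_neg him hsin (cutSqrt_re_pos hz2 (Or.inr hA))
      (hz1 him.ne ?_)
    rw [kim, kre, abs_neg, abs_of_pos hz0]
    linarith
  filter_upwards [key.filter_mono nhdsWithin_le_nhds, self_mem_nhdsWithin] with δ hδ hδ0 t ht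
  have hδ0 : 0 < δ := hδ0
  have := hδ t ⟨by linarith [ht.1], ht.2⟩ hδ0 ht.1
  rwa [mul_neg, ← sub_eq_add_neg] at this

open Filter Topology in
theorem eventually_norm_lt_one_left (h : IsShellSaddle m n α β) :
    ∀ᶠ δ : ℝ in 𝓝[>] 0, ∀ t ∈ Set.Icc (-Real.pi) (β - δ),
      ‖blochFactor m n (Real.cos α + Real.cos β) 0 (t + δ * Complex.I)‖ < 1 := by
  set c := Real.cos α + Real.cos β with hc
  have hc0 : 0 < c := h.cos_add_cos_pos
  have hβpi : β < Real.pi := by linarith [h.alpha_pos, h.add_lt_pi]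
  have key : ∀ᶠ δ : ℝ in 𝓝 0, ∀ t ∈ Set.Icc 0 β, 0 < δ → 0 ≤ t →
      t ≤ β - δ → ‖blochFactor m n c 0 (t + δ * Complex.I)‖ < 1 := by
    refine isCompact_Icc.eventually_forall_of_forall_eventually fun t₀ ht₀ => ?_
    have hE : ∀ᶠ k in 𝓝 (t₀ : ℂ), 0 < β → k.im ≠ 0 → |k.im| ≤ β - k.re →
        0 < (n * (cutSqrt (shellCos c 0 k)).re) ^ 2 - (m * (Complex.sin k).re) ^ 2 -
          n ^ 2 * (shellCos c 0 k).im ^ 2 := by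
      by_cases hβ0 : 0 < β
      swap
      · exact Eventually.of_forall fun k hk => absurd hk hβ0
      have hsinβ := Real.sin_pos_of_pos_of_lt_pi hβ0 hβpi
      have hm : (0 : ℝ) < m := by exact_mod_cast h.pos
      have hn : 0 < n := by
        have h1 := mul_pos hm hsinβ
        rw [h.normal] at h1
        exact_mod_cast pos_of_mul_pos_left h1 h.sin_alpha_pos.le
      rcases ht₀.2.eq_or_lt with hb | hb
      · subst hb
        have hs : HasFDerivAt (fun k : ℂ => (Complex.sin k).re)
            (Real.cos t₀ • Complex.reCLM) (t₀ : ℂ) := by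
          refine (Complex.reCLM.hasFDerivAt.comp (t₀ : ℂ)
            ((Complex.hasDerivAt_sin (t₀ : ℂ)).hasFDerivAt.restrictScalars ℝ)).congr_fderiv ?_
          ext v
          simp [← Complex.ofReal_cos, mul_comm]
        have hi : HasFDerivAt (fun k : ℂ => (shellCos c 0 k).im)
            (Real.sin t₀ • Complex.imCLM) (t₀ : ℂ) := by
          refine (Complex.imCLM.hasFDerivAt.comp (t₀ : ℂ)
            ((hasDerivAt_shellCos c 0 (t₀ : ℂ)).hasFDerivAt.restrictScalars ℝ)).congr_fderiv ?_
          ext v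
          simp [← Complex.ofReal_sin, mul_comm]
        have h1 := (((h.hasFDerivAt_re_cutSqrt.const_mul (n : ℝ)).pow 2).sub
          ((hs.const_mul (m : ℝ)).pow 2)).sub ((hi.pow 2).const_mul ((n : ℝ) ^ 2))
        have hsin := h.sin_alpha_pos
        have hcR : (cutSqrt (shellCos (Real.cos α + Real.cos t₀) 0 t₀)).re = Real.sin α := by
          rw [h.cutSqrt_shellCos, Complex.ofReal_re]
        have hsR : (Complex.sin t₀).re = Real.sin t₀ := by
          rw [← Complex.ofReal_sin, Complex.ofReal_re]
        have hiR : (shellCos c 0 t₀).im = 0 := by rw [shellCos_ofReal, Complex.ofReal_im]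
        refine (eventually_sign_of_hasFDerivAt
          (C := 2 * m * Real.sin t₀ *
            (m * Real.cos t₀ * Real.sin α + n * Real.cos α * Real.sin t₀) / Real.sin α)
          (by have := h.curvature_pos; positivity) h1 ?_ ?_).mono fun k hk _ him => (hk him).1
        · simp only [Pi.sub_apply, hcR, hsR, hiR]
          rw [h.normal]
          ring
        · intro v
          simp [hcR, hsR, hiR]
          field_simp
          linear_combination (v.re * n * Real.cos α) * h.normal
      · have hcos : Real.cos β < Real.cos t₀ :=
          Real.cos_lt_cos_of_nonneg_of_le_pi ht₀.1 hβpi.le hb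
        have hlt1 : c - Real.cos t₀ < 1 := by linarith [h.cos_alpha_lt_one]
        have hgt : -1 < c - Real.cos t₀ := by linarith [Real.cos_le_one t₀]
        have hdom : shellCos c 0 t₀ ∈ branchDomain := by
          rw [shellCos_ofReal]
          exact ⟨by rwa [Complex.ofReal_re], Or.inl (by rwa [Complex.ofReal_re])⟩
        have hcont : ContinuousAt (fun k => (n * (cutSqrt (shellCos c 0 k)).re) ^ 2 -
            (m * (Complex.sin k).re) ^ 2 - n ^ 2 * (shellCos c 0 k).im ^ 2) (t₀ : ℂ) := by
          have h2 : ContinuousAt (fun k => (cutSqrt (shellCos c 0 k)).re) (t₀ : ℂ) :=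
            Complex.continuous_re.continuousAt.comp (hasDerivAt_cutSqrt_shellCos hdom).continuousAt
          have h3 : ContinuousAt (fun k => (shellCos c 0 k).im) (t₀ : ℂ) :=
            Complex.continuous_im.continuousAt.comp (hasDerivAt_shellCos _ _ _).continuousAt
          have h4 : ContinuousAt (fun k : ℂ => (Complex.sin k).re) (t₀ : ℂ) :=
            (Complex.continuous_re.comp Complex.continuous_sin).continuousAt
          exact (((h2.const_mul _).pow 2).sub ((h4.const_mul _).pow 2)).sub ((h3.pow 2).const_mul _)
        refine (continuousAt_const.eventually_lt hcont ?_).mono fun k hk _ _ _ => hk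
        have h5 := h.sq_lt_of_cos_lt hn hcos
        rw [← hc, ← cutSqrt_ofReal hgt hlt1, ← Real.sin_sq] at h5
        rw [shellCos_ofReal, Complex.ofReal_im, ← Complex.ofReal_sin, Complex.ofReal_re]
        linarith
    have hre : ∀ᶠ k in 𝓝 (t₀ : ℂ), (shellCos c 0 k).re ∈ Set.Ioo (-1) 1 := by
      have h1 : ContinuousAt (fun k => (shellCos c 0 k).re) (t₀ : ℂ) :=
        Complex.continuous_re.continuousAt.comp (hasDerivAt_shellCos _ _ _).continuousAt
      refine h1.eventually_mem (Ioo_mem_nhds ?_ ?_)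
      · rw [shellCos_ofReal, Complex.ofReal_re]
        linarith [Real.cos_le_one t₀]
      · rw [shellCos_ofReal, Complex.ofReal_re]
        linarith [h.cos_alpha_lt_one,
          Real.cos_le_cos_of_nonneg_of_le_pi ht₀.1 hβpi.le ht₀.2]
    filter_upwards [eventually_add_mul_I Complex.I (hE.and hre),
      continuous_snd.continuousAt.eventually_lt
        (continuousAt_const (y := Real.pi)) (ht₀.2.trans_lt hβpi)]
      with z ⟨hz1, hz2⟩ hz3 hz0 ht0 hzt
    have kre : ((z.2 : ℂ) + z.1 * Complex.I).re = z.2 := by simp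
    have kim : ((z.2 : ℂ) + z.1 * Complex.I).im = z.1 := by simp
    refine norm_blochFactor_lt_one_of_im_pos (by rwa [kim]) ?_
      (cutSqrt_re_pos hz2.1 (Or.inl hz2.2)) (hz1 (by linarith) ?_ ?_)
    · rw [kre]
      exact Real.sin_nonneg_of_nonneg_of_le_pi ht0 hz3.le
    · rw [kim]
      exact hz0.ne'
    · rw [kim, kre, abs_of_pos hz0]
      linarith
  have hcosh : ∀ᶠ δ : ℝ in 𝓝 0, Real.cosh δ < 1 + c :=
    Real.continuous_cosh.continuousAt.eventually_lt continuousAt_const (by simpa using hc0)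
  filter_upwards [key.filter_mono nhdsWithin_le_nhds, hcosh.filter_mono nhdsWithin_le_nhds,
    self_mem_nhdsWithin] with δ hδ hδc hδ0 t ht
  have hδ0 : 0 < δ := hδ0
  rcases le_or_gt 0 t with ht0 | ht0
  · exact hδ t ⟨ht0, by linarith [ht.2]⟩ hδ0 ht0 ht.2
  have kre : ((t : ℂ) + δ * Complex.I).re = t := by simp
  have kim : ((t : ℂ) + δ * Complex.I).im = δ := by simp
  have hAre : (shellCos c 0 ((t : ℂ) + δ * Complex.I)).re = c - Real.cos t * Real.cosh δ := by
    rw [shellCos_re, kre, kim]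
  have hAim : (shellCos c 0 ((t : ℂ) + δ * Complex.I)).im = Real.sin t * Real.sinh δ := by
    rw [shellCos_im, kre, kim, sub_zero]
  have hpos : 0 < Real.sinh δ := Real.sinh_pos_iff.2 hδ0
  refine norm_blochFactor_lt_one_of_norm_joukowski h.pos (by rw [kim]; exact hδ0.le) ?_
  refine norm_joukowski_lt_one ?_ ?_
  · rw [hAre]
    nlinarith [Real.cos_le_one t, Real.cosh_pos δ]
  · rcases ht.1.eq_or_lt with h1 | h1
    · right
      rw [hAre, hAim, ← h1]
      simp
      linarith [Real.one_le_cosh δ]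
    · left
      rw [hAim]
      exact mul_neg_of_neg_of_pos (Real.sin_neg_of_neg_of_neg_pi_lt ht0 h1) hpos

end IsShellSaddle

namespace IsShellSaddle

variable {m n : ℕ} {α β : ℝ}

theorem norm_lt_one_vertical_left (h : IsShellSaddle m n α β) {s : ℝ} (hs : 0 ≤ s) :
    ‖blochFactor m n (Real.cos α + Real.cos β) 0 ((-Real.pi : ℝ) + s * Complex.I)‖ < 1 := by
  have kre : (((-Real.pi : ℝ) : ℂ) + s * Complex.I).re = -Real.pi := by simp
  have kim : (((-Real.pi : ℝ) : ℂ) + s * Complex.I).im = s := by simp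
  have h1 := Real.one_le_cosh s
  have h2 := h.cos_add_cos_pos
  have hre : 1 < (shellCos (Real.cos α + Real.cos β) 0 ((-Real.pi : ℝ) + s * Complex.I)).re := by
    rw [shellCos_re, kre, kim, Real.cos_neg, Real.cos_pi]
    linarith
  refine norm_blochFactor_lt_one_of_norm_joukowski h.pos (by rwa [kim]) ?_
  refine norm_joukowski_lt_one (by linarith) (Or.inr ⟨hre, ?_⟩)
  rw [shellCos_im, kre, Real.sin_neg, Real.sin_pi]
  simp

open Filter Topology in
theorem tendsto_sqrt_mul_boundary_value (h : IsShellSaddle m n α β) {e : ℝ}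
    (hce : Real.cos α + Real.cos β = 2 - e) {G : ℕ → ℂ}
    (hG : ∀ j : ℕ, Tendsto
      (fun ε : ℝ => latticeGreen ((e : ℂ) + ε * Complex.I) (j * m : ℕ) (j * n : ℕ))
      (𝓝[>] 0) (𝓝 (G j))) :
    Tendsto (fun j : ℕ => Complex.exp (-Complex.I * (m * α + n * β)) ^ j *
        ((√(j : ℝ) : ℂ) * G j)) atTop
      (𝓝 ((2 * Real.pi)⁻¹ * ((1 - Complex.I) * (Complex.I / (Real.sin α : ℝ) * (√(Real.pi /
        ((m * Real.cos β * Real.sin α + n * Real.cos α * Real.sin β) /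
          Real.sin α ^ 2)) : ℝ))))) := by
  obtain ⟨ρ, hρ, hball⟩ := Metric.eventually_nhds_iff_ball.1 h.eventually_shellCos_re
  obtain ⟨r, hr, hvert⟩ := Metric.eventually_nhds_iff_ball.1 h.eventually_norm_lt_one_vertical
  have hcosh : ∀ᶠ δ : ℝ in 𝓝 0, Real.cosh δ < 1 + (Real.cos α + Real.cos β) :=
    Real.continuous_cosh.continuousAt.eventually_lt continuousAt_const
      (by simpa using h.cos_add_cos_pos)
  have hβ := h.beta_nonneg
  have hβπ : 0 < Real.pi - β := by linarith [h.alpha_pos, h.add_lt_pi]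
  have hsmall : ∀ᶠ δ : ℝ in 𝓝 0, δ < ρ / 2 ∧ δ < r ∧ δ < Real.pi - β :=
    (eventually_lt_nhds (half_pos hρ)).and ((eventually_lt_nhds hr).and (eventually_lt_nhds hβπ))
  obtain ⟨δ, hdiag, hL, hR, hc, ⟨h1, h2, h3⟩, hδ⟩ := (h.eventually_tendsto_diagonal.and
    (h.eventually_norm_lt_one_left.and (h.eventually_norm_lt_one_right.and
    ((hcosh.filter_mono nhdsWithin_le_nhds).and ((hsmall.filter_mono nhdsWithin_le_nhds).and
    self_mem_nhdsWithin))))).exists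
  have hδ : 0 < δ := hδ
  refine tendsto_sqrt_mul_boundary_value_of_contour h.alpha_pos hβ h.add_lt_pi h.cos_add_cos_pos
    h.cos_beta_pos hce m n hG hδ (by linarith) hc (by linarith) (by linarith) hball hL
    (fun s hs => h.norm_lt_one_vertical_left hs.1) hR (fun s hs => hvert _ ?_) ?_ hdiag
  · rw [mem_ball_iff_norm, add_sub_cancel_left, norm_mul, Complex.norm_I, mul_one,
      Complex.norm_real, Real.norm_eq_abs, abs_lt]
    exact ⟨by linarith [hs.1], by linarith [hs.2]⟩
  · rw [show -Complex.I * (m * α + n * β) = ((-(m * α + n * β) : ℝ) : ℂ) * Complex.I by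
      push_cast; ring]
    exact Complex.norm_exp_ofReal_mul_I _

theorem sqrt_mul_eq_exp (h : IsShellSaddle m n α β) :
    (√(2 * Real.pi * (m * Real.cos β * Real.sin α + n * Real.cos α * Real.sin β)) : ℂ) *
      ((2 * Real.pi)⁻¹ * ((1 - Complex.I) * (Complex.I / (Real.sin α : ℝ) * (√(Real.pi /
        ((m * Real.cos β * Real.sin α + n * Real.cos α * Real.sin β) /
          Real.sin α ^ 2)) : ℝ)))) = Complex.exp (Complex.I * (Real.pi / 4 : ℝ)) := by
  have hs := h.sin_alpha_pos
  have hκ := h.curvature_pos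
  set κ := m * Real.cos β * Real.sin α + n * Real.cos α * Real.sin β
  have h1 : √(2 * Real.pi * κ) * √(Real.pi / (κ / Real.sin α ^ 2)) =
      √2 * Real.pi * Real.sin α := by
    rw [← Real.sqrt_mul (by positivity), show 2 * Real.pi * κ * (Real.pi / (κ / Real.sin α ^ 2)) =
      2 * (Real.pi * Real.sin α) ^ 2 by field_simp, Real.sqrt_mul (by norm_num),
      Real.sqrt_sq (by positivity), mul_assoc]
  have h2 : (√(2 * Real.pi * κ) : ℂ) * (√(Real.pi / (κ / Real.sin α ^ 2)) : ℝ) =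
      (√2 : ℝ) * Real.pi * (Real.sin α : ℝ) := by
    exact_mod_cast h1
  have h3 : Complex.exp (Complex.I * (Real.pi / 4 : ℝ)) =
      ((√2 / 2 : ℝ) : ℂ) * (1 + Complex.I) := by
    rw [mul_comm, Complex.exp_mul_I, ← Complex.ofReal_cos, ← Complex.ofReal_sin,
      Real.cos_pi_div_four, Real.sin_pi_div_four]
    ring
  rw [h3]
  have hs' : ((Real.sin α : ℝ) : ℂ) ≠ 0 := by exact_mod_cast hs.ne'
  have hπ : (Real.pi : ℂ) ≠ 0 := by exact_mod_cast Real.pi_ne_zero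
  calc _ = ((2 * Real.pi : ℝ) : ℂ)⁻¹ * ((1 - Complex.I) * (Complex.I / (Real.sin α : ℝ) *
        ((√(2 * Real.pi * κ) : ℂ) * (√(Real.pi / (κ / Real.sin α ^ 2)) : ℝ)))) := by
        push_cast
        ring
    _ = _ := by
        rw [h2]
        push_cast [-Complex.ofReal_sin]
        field_simp
        linear_combination -Complex.I_sq

open Filter Topology in
theorem tendsto_boundary_value_sub_exp (h : IsShellSaddle m n α β) {e : ℝ}
    (hce : Real.cos α + Real.cos β = 2 - e) {G : ℕ → ℂ}
    (hG : ∀ j : ℕ, Tendsto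
      (fun ε : ℝ => latticeGreen ((e : ℂ) + ε * Complex.I) (j * m : ℕ) (j * n : ℕ))
      (𝓝[>] 0) (𝓝 (G j))) :
    Tendsto (fun j : ℕ =>
      (√(2 * Real.pi * (m * Real.cos β * Real.sin α + n * Real.cos α * Real.sin β) * j) : ℂ) * G j -
        Complex.exp (Complex.I * (j * (m * α + n * β) + Real.pi / 4 : ℝ))) atTop (𝓝 0) := by
  have h1 := (h.tendsto_sqrt_mul_boundary_value hce hG).const_mul
    (√(2 * Real.pi * (m * Real.cos β * Real.sin α + n * Real.cos α * Real.sin β)) : ℂ)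
  rw [h.sqrt_mul_eq_exp, ← tendsto_sub_nhds_zero_iff, tendsto_zero_iff_norm_tendsto_zero] at h1
  rw [tendsto_zero_iff_norm_tendsto_zero]
  refine h1.congr fun j => ?_
  have hκ := h.curvature_pos
  rw [Real.sqrt_mul (x := 2 * Real.pi * _) (by positivity) (j : ℝ)]
  have hw : ‖Complex.exp (-Complex.I * (m * α + n * β)) ^ j‖ = 1 := by
    rw [show -Complex.I * (m * α + n * β) = ((-(m * α + n * β) : ℝ) : ℂ) * Complex.I by
      push_cast; ring, norm_pow, Complex.norm_exp_ofReal_mul_I, one_pow]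
  rw [← one_mul ‖(_ : ℂ) * G j - _‖, ← hw, ← norm_mul, mul_sub]
  congr 2
  · push_cast
    ring
  · rw [← Complex.exp_nat_mul, ← Complex.exp_add]
    congr 1
    push_cast
    ring

end IsShellSaddle

open Filter Topology in
theorem cos_sub_ne_zero_of_stationary {K : ℝ → ℝ} {c φ θ : ℝ} (hc : c ≠ 2)
    (hK : ∀ t, Real.cos (K t * Real.cos t) + Real.cos (K t * Real.sin t) = c)
    (hstat : HasDerivAt (fun t => K t * Real.cos (φ - t)) 0 θ) : Real.cos (φ - θ) ≠ 0 := by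
  intro h0
  have hsin : Real.sin (φ - θ) ≠ 0 := by
    intro h1
    have := Real.sin_sq_add_cos_sq (φ - θ)
    rw [h0, h1] at this
    norm_num at this
  have hcos : HasDerivAt (fun t => Real.cos (φ - t)) (Real.sin (φ - θ)) θ := by
    simpa using ((hasDerivAt_id θ).const_sub φ).cos
  have h1 := hstat.tendsto_slope.div hcos.tendsto_slope hsin
  rw [zero_div] at h1
  have hK0 : Tendsto K (𝓝[≠] θ) (𝓝 0) := by
    refine h1.congr' ?_
    filter_upwards [hcos.tendsto_slope.eventually_ne hsin] with t ht
    rw [Pi.div_apply, div_eq_iff ht]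
    simp only [slope_def_field, h0]
    ring
  have hlim (f : ℝ → ℝ) (hf : Continuous f) :
      Tendsto (fun t => Real.cos (K t * f t)) (𝓝[≠] θ) (𝓝 1) := by
    have h2 := hK0.mul (hf.continuousAt.tendsto.mono_left (nhdsWithin_le_nhds (s := {θ}ᶜ)))
    have h4 := (Real.continuous_cos.tendsto _).comp h2
    rw [zero_mul, Real.cos_zero] at h4
    exact h4
  have h3 := (hlim _ Real.continuous_cos).add (hlim _ Real.continuous_sin)
  simp only [hK] at h3
  have := tendsto_nhds_unique h3 tendsto_const_nhds
  norm_num at this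
  exact hc this.symm

theorem cos_mul_sin_eq_of_stationary {K : ℝ → ℝ} {c φ θ : ℝ} (hc : c ≠ 2) (hpos : 0 < K θ)
    (hK : ∀ t, Real.cos (K t * Real.cos t) + Real.cos (K t * Real.sin t) = c)
    (hstat : HasDerivAt (fun t => K t * Real.cos (φ - t)) 0 θ) :
    Real.cos φ * Real.sin (K θ * Real.sin θ) = Real.sin φ * Real.sin (K θ * Real.cos θ) := by
  have hne := cos_sub_ne_zero_of_stationary hc hK hstat
  have hcos : HasDerivAt (fun t => Real.cos (φ - t)) (Real.sin (φ - θ)) θ := by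
    simpa using ((hasDerivAt_id θ).const_sub φ).cos
  obtain ⟨K', hK'⟩ : ∃ K', HasDerivAt K K' θ := by
    refine ⟨_, (hstat.div hcos hne).congr_of_eventuallyEq ?_⟩
    filter_upwards [hcos.continuousAt.eventually_ne hne] with t ht
    simp only [Pi.div_apply]
    exact (mul_div_cancel_right₀ _ ht).symm
  have h1 := (hK'.mul hcos).unique hstat
  have h2 := ((hK'.mul (Real.hasDerivAt_cos θ)).cos.add
    (hK'.mul (Real.hasDerivAt_sin θ)).cos).unique
    ((hasDerivAt_const θ c).congr_of_eventuallyEq (Filter.Eventually.of_forall hK))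
  simp only [Pi.mul_apply] at h2
  refine mul_left_cancel₀ hpos.ne' ?_
  rw [Real.cos_sub, Real.sin_sub] at h1
  linear_combination (-(Real.cos φ * Real.cos θ + Real.sin φ * Real.sin θ)) * h2 -
    (Real.sin (K θ * Real.cos θ) * Real.cos θ + Real.sin (K θ * Real.sin θ) * Real.sin θ) * h1 -
    K θ * (Real.cos φ * Real.sin (K θ * Real.sin θ) -
      Real.sin φ * Real.sin (K θ * Real.cos θ)) * Real.sin_sq_add_cos_sq θ

open Filter Topology in
theorem tendsto_boundary_value_sub_exp_of_normal {e a b : ℝ} (he : e ∈ Set.Ioo (0 : ℝ) 2)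
    (ha : 0 ≤ a) (hb : 0 ≤ b) (hab : a + b < Real.pi) (hce : Real.cos a + Real.cos b = 2 - e)
    {m n : ℕ} (hmn : ¬(m = 0 ∧ n = 0)) (hnormal : m * Real.sin b = n * Real.sin a) {G : ℕ → ℂ}
    (hG : ∀ j : ℕ, Tendsto
      (fun ε : ℝ => latticeGreen ((e : ℂ) + ε * Complex.I) (j * m : ℕ) (j * n : ℕ))
      (𝓝[>] 0) (𝓝 (G j))) :
    Tendsto (fun j : ℕ =>
      (√(2 * Real.pi * (m * Real.cos b * Real.sin a + n * Real.cos a * Real.sin b) * j) : ℂ) * G j -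
        Complex.exp (Complex.I * (j * (m * a + n * b) + Real.pi / 4 : ℝ))) atTop (𝓝 0) := by
  obtain ⟨he0, he2⟩ := he
  have pos_of {x y : ℝ} {p q : ℕ} (hx : 0 ≤ x) (hy : 0 ≤ y) (hxy : x + y < Real.pi)
      (hc : Real.cos x + Real.cos y = 2 - e) (hp : 0 < p)
      (h : p * Real.sin y = q * Real.sin x) : 0 < x := by
    refine hx.lt_of_ne fun h0 => ?_
    rw [← h0] at hxy hc h
    have hp' : (p : ℝ) ≠ 0 := by exact_mod_cast hp.ne'
    have hsin : Real.sin y = 0 := by simpa [hp'] using h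
    have hy0 : y = 0 := by
      by_contra hne
      exact (Real.sin_pos_of_pos_of_lt_pi (hy.lt_of_ne' hne) (by linarith)).ne' hsin
    rw [hy0, Real.cos_zero] at hc
    linarith
  rcases le_total n m with hnm | hnm
  · have hm : 0 < m := by omega
    exact IsShellSaddle.tendsto_boundary_value_sub_exp
      ⟨pos_of ha hb hab hce hm hnormal, hb, hab, by linarith, hm, hnm, hnormal⟩ hce hG
  · have hn : 0 < n := by omega
    have hce' : Real.cos b + Real.cos a = 2 - e := by rw [add_comm, hce]
    have hab' : b + a < Real.pi := by rwa [add_comm]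
    have := IsShellSaddle.tendsto_boundary_value_sub_exp (m := n) (n := m) (α := b) (β := a)
      ⟨pos_of hb ha hab' hce' hn hnormal.symm, ha, hab', by linarith, hn, hnm, hnormal.symm⟩ hce'
      (G := G) (fun j => by simpa only [latticeGreen_swap _ (j * m : ℕ)] using hG j)
    refine this.congr fun j => ?_
    rw [add_comm (n * Real.cos a * Real.sin b), add_comm ((n : ℝ) * b)]

open Filter Topology in
/-- Leading asymptotics of the boundary value of the lattice Green's function along a
lattice ray: an outgoing circular wave,
`g₊(e;x) ∼ exp(i(|x| K_s cos(φ-θ_s) + π/4)) / sqrt(2π ψ(e,φ) |x|)`. -/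
theorem latticeGreen_boundary_asymptotics
    (gp : ℝ → ℤ → ℤ → ℂ)
    (hgp : ∀ e ∈ Set.Ioo (0 : ℝ) 4, e ≠ 2 → ∀ x₁ x₂ : ℤ,
      Tendsto (fun ε : ℝ => latticeGreen ((e : ℂ) + ε * Complex.I) x₁ x₂)
        (𝓝[>] 0) (𝓝 (gp e x₁ x₂)))
    (K : ℝ → ℝ → ℝ)
    (hK : ∀ e ∈ Set.Ioo (0 : ℝ) 2, ∀ θ : ℝ,
      0 < K e θ ∧ |K e θ * Real.cos θ| + |K e θ * Real.sin θ| < Real.pi ∧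
        Real.cos (K e θ * Real.cos θ) + Real.cos (K e θ * Real.sin θ) = 2 - e)
    (e : ℝ) (he : e ∈ Set.Ioo (0 : ℝ) 2)
    (m₀ n₀ : ℤ) (hm : 0 ≤ m₀) (hn : 0 ≤ n₀) (hmn : ¬(m₀ = 0 ∧ n₀ = 0))
    (φ : ℝ) (hφ : φ ∈ Set.Icc 0 (Real.pi / 2))
    (hφcos : Real.cos φ = (m₀ : ℝ) / Real.sqrt ((m₀ : ℝ) ^ 2 + (n₀ : ℝ) ^ 2))
    (hφsin : Real.sin φ = (n₀ : ℝ) / Real.sqrt ((m₀ : ℝ) ^ 2 + (n₀ : ℝ) ^ 2))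
    (θs : ℝ) (hθs : θs ∈ Set.Icc 0 (Real.pi / 2))
    (hstat : HasDerivAt (fun θ : ℝ => K e θ * Real.cos (φ - θ)) 0 θs) :
    Tendsto
      (fun j : ℕ =>
        (Real.sqrt (2 * Real.pi *
            (Real.cos (K e θs * Real.cos θs) * Real.sin (K e θs * Real.sin θs) * Real.sin φ +
              Real.cos (K e θs * Real.sin θs) * Real.sin (K e θs * Real.cos θs) * Real.cos φ) *
            ((j : ℝ) * Real.sqrt ((m₀ : ℝ) ^ 2 + (n₀ : ℝ) ^ 2))) : ℂ) *
          gp e ((j : ℤ) * m₀) ((j : ℤ) * n₀) -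
        Complex.exp (Complex.I *
          (((j : ℝ) * Real.sqrt ((m₀ : ℝ) ^ 2 + (n₀ : ℝ) ^ 2) * K e θs *
              Real.cos (φ - θs) + Real.pi / 4 : ℝ) : ℂ)))
      atTop (𝓝 0) := by
  obtain ⟨m, rfl⟩ := Int.eq_ofNat_of_zero_le hm
  obtain ⟨n, rfl⟩ := Int.eq_ofNat_of_zero_le hn
  simp only [Int.cast_natCast] at hφcos hφsin ⊢
  obtain ⟨hpos, hlt, hshell⟩ := hK e he θs
  have hsum : (0 : ℝ) < (m : ℝ) ^ 2 + (n : ℝ) ^ 2 := by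
    rcases Nat.eq_zero_or_pos m with h | h
    · have : 0 < n := by
        have := Nat.eq_zero_or_pos n
        tauto
      positivity
    · positivity
  have hr := Real.sqrt_pos.2 hsum
  set r := √((m : ℝ) ^ 2 + (n : ℝ) ^ 2)
  rw [eq_div_iff hr.ne'] at hφcos hφsin
  have hsin := Real.sin_nonneg_of_nonneg_of_le_pi hθs.1 (by linarith [hθs.2, Real.pi_pos])
  have hcos := Real.cos_nonneg_of_mem_Icc (x := θs) ⟨by linarith [hθs.1, Real.pi_pos], hθs.2⟩
  have ha := mul_nonneg hpos.le hcos
  have hb := mul_nonneg hpos.le hsin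
  rw [abs_of_nonneg ha, abs_of_nonneg hb] at hlt
  have hstat' := cos_mul_sin_eq_of_stationary (by linarith [he.1] : 2 - e ≠ 2) hpos
    (fun t => (hK e he t).2.2) hstat
  have hnormal : m * Real.sin (K e θs * Real.sin θs) = n * Real.sin (K e θs * Real.cos θs) := by
    rw [← hφcos, ← hφsin]
    linear_combination r * hstat'
  have hmain := tendsto_boundary_value_sub_exp_of_normal he ha hb hlt hshell (m := m) (n := n)
    (fun h => hmn ⟨by simpa using h.1, by simpa using h.2⟩) hnormal
    (G := fun j => gp e (j * m : ℕ) (j * n : ℕ))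
    (fun j => hgp e ⟨he.1, by linarith [he.2]⟩ he.2.ne _ _)
  refine hmain.congr fun j => ?_
  rw [Real.cos_sub, ← hφcos, ← hφsin]
  push_cast
  congr 4
  · ring_nf
  · ring_nf
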